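/- arXiv:1703.10953 — 3 statements merged into one kernel-verified Lean document; each statement's English description precedes it below -/
import Mathlib

section
/- Fix a real number α with 1 < α < 2. There exist constants C > 0 and K ≥ 0 such that for all real N ≥ 16, the number of integers n with 1 < n ≤ N satisfying all three conditions ω(n) ≤ α log log N, P(n) > N^{1/log log N}, and n = ab for some positive integers a, b with a² + b² prime, is at most C · N · (log log N)^K · (log N)^{α(1 + log 2 − log α) − 2}. -/
open Real

/-- The largest prime factor of `n`, with the convention that `P(1) = 1`. -/
def maxPrimeFac (n : ℕ) : ℕ := if n ≤ 1 then 1 else n.primeFactors.sup id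

lemma exp_tsum_neg_log_one_sub {N : ℕ} (χ : DirichletCharacter ℂ N) (ψ : ℕ → ℝ)
    (hψ : ∀ n : ℕ, χ n = ψ n) {s : ℝ} (hs : 1 < s) :
    Real.exp (∑' p : Nat.Primes, -Real.log (1 - ψ p * (p : ℝ) ^ (-s))) =
      ‖LSeries (fun n : ℕ => χ n) (s : ℂ)‖ := by
  rw [← DirichletCharacter.LSeries_eulerProduct_exp_log χ (s := (s : ℂ)) (by simpa using hs),
    Complex.norm_exp]
  have habs : ∀ n : ℕ, |ψ n| ≤ 1 := fun n => by
    have := χ.norm_le_one (n : ZMod N)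
    rw [hψ n] at this
    simpa using this
  have key : ∀ p : Nat.Primes, -Complex.log (1 - χ (p : ℕ) * ((p : ℕ) : ℂ) ^ (-(s : ℂ))) =
      ((-Real.log (1 - ψ p * (p : ℝ) ^ (-s)) : ℝ) : ℂ) := by
    intro p
    have h1 : (p : ℝ) ^ (-s) ≤ 1 :=
      Real.rpow_le_one_of_one_le_of_nonpos (by exact_mod_cast p.2.one_lt.le) (by linarith)
    have h2 : ψ p * (p : ℝ) ^ (-s) ≤ 1 := by
      have h3 : 0 ≤ (p : ℝ) ^ (-s) := by positivity
      have := habs p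
      rw [abs_le] at this
      nlinarith
    rw [hψ, Complex.ofReal_neg, Complex.ofReal_log (by linarith)]
    push_cast
    rw [Complex.ofReal_cpow (by positivity)]
    push_cast
    rfl
  simp_rw [key]
  rw [← Complex.ofReal_tsum, Complex.ofReal_re]

lemma summable_primes_rpow_neg {s : ℝ} (hs : 1 < s) :
    Summable (fun p : Nat.Primes => (p : ℝ) ^ (-s)) :=
  Nat.Primes.summable_rpow.mpr (by linarith)

lemma le_neg_log_one_sub {w : ℝ} (hw : w < 1) : w ≤ -Real.log (1 - w) := by
  have := Real.log_le_sub_one_of_pos (x := 1 - w) (by linarith)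
  linarith

lemma neg_log_one_sub_le {w : ℝ} (hw : |w| ≤ 1 / 2) : -Real.log (1 - w) ≤ w + w ^ 2 * 2 := by
  rw [abs_le] at hw
  have h := Real.one_sub_inv_le_log_of_pos (x := 1 - w) (by linarith)
  have h1 : (1 - w)⁻¹ ≤ 1 + w + 2 * w ^ 2 := by
    rw [inv_le_iff_one_le_mul₀ (by linarith)]
    nlinarith [mul_nonneg (sq_nonneg w) (by linarith : 0 ≤ 1 - 2 * w)]
  linarith

/-- For a real-valued character, `log |L(s, χ)|` agrees with the prime sum up to `O(1)`. -/
lemma log_norm_LSeries_bounds {N : ℕ} (χ : DirichletCharacter ℂ N) (ψ : ℕ → ℝ)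
    (hψ : ∀ n : ℕ, χ n = ψ n) {s : ℝ} (hs : 1 < s) :
    0 < ‖LSeries (fun n : ℕ => χ n) (s : ℂ)‖ ∧
    ∑' p : Nat.Primes, ψ p * (p : ℝ) ^ (-s) ≤
        Real.log ‖LSeries (fun n : ℕ => χ n) (s : ℂ)‖ ∧
      Real.log ‖LSeries (fun n : ℕ => χ n) (s : ℂ)‖ ≤
        ∑' p : Nat.Primes, ψ p * (p : ℝ) ^ (-s) + 2 * ∑' p : Nat.Primes, (p : ℝ) ^ (-2 : ℝ) := by
  rw [← exp_tsum_neg_log_one_sub χ ψ hψ hs, Real.log_exp]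
  have habs : ∀ n : ℕ, |ψ n| ≤ 1 := fun n => by
    have := χ.norm_le_one (n : ZMod N)
    rw [hψ n] at this
    simpa using this
  have hhalf : ∀ p : Nat.Primes, (p : ℝ) ^ (-s) ≤ 1 / 2 := fun p => by
    have h2 : (2 : ℝ) ≤ p := by exact_mod_cast p.2.two_le
    calc (p : ℝ) ^ (-s) ≤ (p : ℝ) ^ (-1 : ℝ) :=
          Real.rpow_le_rpow_of_exponent_le (by linarith) (by linarith)
      _ = 1 / p := by rw [Real.rpow_neg_one, one_div]
      _ ≤ 1 / 2 := one_div_le_one_div_of_le (by norm_num) h2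
  have hw : ∀ p : Nat.Primes, |ψ p * (p : ℝ) ^ (-s)| ≤ (p : ℝ) ^ (-s) := fun p => by
    rw [abs_mul, abs_of_nonneg (by positivity : 0 ≤ (p : ℝ) ^ (-s))]
    exact mul_le_of_le_one_left (by positivity) (habs p)
  have hsum : Summable (fun p : Nat.Primes => ψ p * (p : ℝ) ^ (-s)) :=
    Summable.of_norm_bounded (summable_primes_rpow_neg hs) hw
  have hsum2 := summable_primes_rpow_neg (s := 2) (by norm_num)
  have hlow : ∀ p : Nat.Primes, ψ p * (p : ℝ) ^ (-s) ≤ -Real.log (1 - ψ p * (p : ℝ) ^ (-s)) :=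
    fun p => le_neg_log_one_sub
      (by have := (le_abs_self _).trans ((hw p).trans (hhalf p)); linarith)
  have hup : ∀ p : Nat.Primes, -Real.log (1 - ψ p * (p : ℝ) ^ (-s)) ≤
      ψ p * (p : ℝ) ^ (-s) + 2 * (p : ℝ) ^ (-2 : ℝ) := fun p => by
    refine (neg_log_one_sub_le ((hw p).trans (hhalf p))).trans ?_
    have h1 : (ψ p * (p : ℝ) ^ (-s)) ^ 2 ≤ (p : ℝ) ^ (-2 : ℝ) := by
      have h1p : (1 : ℝ) ≤ p := by exact_mod_cast p.2.one_lt.le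
      calc (ψ p * (p : ℝ) ^ (-s)) ^ 2 = |ψ p * (p : ℝ) ^ (-s)| ^ 2 := (sq_abs _).symm
        _ ≤ ((p : ℝ) ^ (-s)) ^ 2 := by gcongr; exact hw p
        _ = (p : ℝ) ^ (-s * 2) := by
          rw [Real.rpow_mul (by positivity)]; norm_cast
        _ ≤ _ := Real.rpow_le_rpow_of_exponent_le h1p (by linarith)
    linarith
  have hsum3 := hsum.add (hsum2.mul_left 2)
  have hsum4 : Summable (fun p : Nat.Primes => -Real.log (1 - ψ p * (p : ℝ) ^ (-s))) := by
    have : Summable (fun p : Nat.Primes => -Real.log (1 - ψ p * (p : ℝ) ^ (-s)) -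
        ψ p * (p : ℝ) ^ (-s)) :=
      Summable.of_nonneg_of_le (fun p => by linarith [hlow p]) (fun p => by linarith [hup p])
        (hsum2.mul_left 2)
    simpa using this.add hsum
  refine ⟨Real.exp_pos _, hsum.tsum_le_tsum hlow hsum4, ?_⟩
  rw [← tsum_mul_left, ← hsum.tsum_add (hsum2.mul_left 2)]
  exact hsum4.tsum_le_tsum hup hsum3

open Filter Topology in
lemma eventually_tsum_primes_le :
    ∃ C : ℝ, ∀ᶠ s : ℝ in 𝓝[>] 1, |∑' p : Nat.Primes, (p : ℝ) ^ (-s) - Real.log (1 / (s - 1))| ≤ C := by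
  have h1 : Tendsto (fun s : ℝ => ‖((s : ℂ) - 1) * riemannZeta s‖) (𝓝[>] 1) (𝓝 ‖(1 : ℂ)‖) := by
    have : Tendsto (fun s : ℝ => (s : ℂ)) (𝓝[>] 1) (𝓝[≠] 1) :=
      tendsto_nhdsWithin_iff.mpr ⟨(Complex.continuous_ofReal.tendsto' 1 1 (by simp)).mono_left
        nhdsWithin_le_nhds, by
          filter_upwards [self_mem_nhdsWithin] with s hs
          simpa using (ne_of_gt hs : s ≠ 1)⟩
    exact (riemannZeta_residue_one.comp this).norm
  rw [norm_one] at h1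
  have h2 := (Real.continuousAt_log one_ne_zero).tendsto.comp h1
  rw [Real.log_one] at h2
  have h3 := (tendsto_order.1 h2).1 (-1) (by norm_num)
  have h4 := (tendsto_order.1 h2).2 1 (by norm_num)
  refine ⟨1 + 2 * ∑' p : Nat.Primes, (p : ℝ) ^ (-2 : ℝ), ?_⟩
  filter_upwards [h3, h4, self_mem_nhdsWithin] with s h3 h4 hs
  have hs : 1 < s := hs
  obtain ⟨hp, hb1, hb2⟩ := log_norm_LSeries_bounds (1 : DirichletCharacter ℂ 1) (fun _ => 1)
    (fun n => by simp [MulChar.one_apply <| isUnit_of_subsingleton _]) hs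
  have hz : ‖LSeries (fun n : ℕ => (1 : DirichletCharacter ℂ 1) n) (s : ℂ)‖ = ‖riemannZeta s‖ := by
    rw [← LSeries_one_eq_riemannZeta (by simpa using hs)]
    congr 2
    ext n
    simp [MulChar.one_apply <| isUnit_of_subsingleton _]
  rw [hz] at hp hb1 hb2
  have hn : ‖(s : ℂ) - 1‖ = s - 1 := by
    rw [← Complex.ofReal_one, ← Complex.ofReal_sub, Complex.norm_real, Real.norm_of_nonneg]
    linarith
  simp only [Function.comp, norm_mul, hn] at h3 h4
  rw [Real.log_mul (by linarith) hp.ne'] at h3 h4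
  simp only [one_mul] at hb1 hb2
  have hnn : 0 ≤ ∑' p : Nat.Primes, (p : ℝ) ^ (-2 : ℝ) := tsum_nonneg fun p => by positivity
  rw [one_div, Real.log_inv, abs_le]
  constructor <;> linarith

open Filter Topology in
lemma eventually_tsum_primes_chi_ge :
    ∃ C : ℝ, ∀ᶠ s : ℝ in 𝓝[>] 1,
      -C ≤ ∑' p : Nat.Primes, (ZMod.χ₄ ((p : ℕ) : ZMod 4) : ℝ) * (p : ℝ) ^ (-s) := by
  set χ : DirichletCharacter ℂ 4 := ZMod.χ₄.ringHomComp (Int.castRingHom ℂ) with hχ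
  have hne : χ ≠ 1 := by
    intro h
    have := congrArg (fun f => f ((3 : ℕ) : ZMod 4)) h
    rw [hχ] at this
    simp only [MulChar.ringHomComp_apply] at this
    rw [ZMod.χ₄_nat_three_mod_four (by norm_num), MulChar.one_apply (by decide)] at this
    norm_num at this
  have hL := DirichletCharacter.LFunction_apply_one_ne_zero hne
  have h1 : Tendsto (fun s : ℝ => ‖DirichletCharacter.LFunction χ (s : ℂ)‖) (𝓝[>] 1)
      (𝓝 ‖DirichletCharacter.LFunction χ 1‖) := by
    have hc : Continuous fun s : ℝ => ‖DirichletCharacter.LFunction χ (s : ℂ)‖ :=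
      ((DirichletCharacter.differentiable_LFunction hne).continuous.comp
        Complex.continuous_ofReal).norm
    exact (hc.tendsto' 1 _ (by simp)).mono_left nhdsWithin_le_nhds
  have h2 := (Real.continuousAt_log (norm_ne_zero_iff.mpr hL)).tendsto.comp h1
  have h3 := (tendsto_order.1 h2).1 (Real.log ‖DirichletCharacter.LFunction χ 1‖ - 1) (by linarith)
  refine ⟨-(Real.log ‖DirichletCharacter.LFunction χ 1‖ - 1) +
    2 * ∑' p : Nat.Primes, (p : ℝ) ^ (-2 : ℝ), ?_⟩
  filter_upwards [h3, self_mem_nhdsWithin] with s h3 hs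
  have hs : 1 < s := hs
  obtain ⟨hp, hb1, hb2⟩ := log_norm_LSeries_bounds χ (fun n => (ZMod.χ₄ (n : ZMod 4) : ℝ))
    (fun n => by simp [hχ, MulChar.ringHomComp_apply]) hs
  simp only [Function.comp] at h3
  rw [DirichletCharacter.LFunction_eq_LSeries χ (s := (s : ℂ)) (by simpa using hs)] at h3
  linarith

lemma tsum_primes_ite_eq_sum (f : ℕ → ℝ) (n : ℕ) :
    HasSum (fun p : Nat.Primes => if (p : ℕ) < n then f p else 0) (∑ p ∈ Nat.primesBelow n, f p) := by
  have hz : ∀ p ∉ Nat.primesBelow n, ({p | Nat.Prime p} : Set ℕ).indicator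
      (fun p => if p < n then f p else 0) p = 0 := by
    intro p hp
    rw [Nat.mem_primesBelow] at hp
    by_cases h : Nat.Prime p
    · simp [show ¬ p < n from fun h' => hp ⟨h', h⟩]
    · simp [h]
  have h : HasSum _ _ := hasSum_sum_of_ne_finset_zero hz
  have h2 := (hasSum_subtype_iff_indicator (s := {p | Nat.Prime p})
    (f := fun p : ℕ => if p < n then f p else 0)).2 h
  have e : ∑ p ∈ Nat.primesBelow n, ({p | Nat.Prime p} : Set ℕ).indicator
      (fun p => if p < n then f p else 0) p = ∑ p ∈ Nat.primesBelow n, f p := by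
    refine Finset.sum_congr rfl fun p hp => ?_
    rw [Nat.mem_primesBelow] at hp
    simp [hp.1, hp.2]
  rw [e] at h2
  exact h2

open Filter Topology in
/-- A weak form of Mertens' second theorem: upper bound. -/
lemma sum_primes_inv_le :
    ∃ C : ℝ, 0 ≤ C ∧ ∀ᶠ x : ℝ in atTop, ∑ p ∈ Nat.primesBelow (⌊x⌋₊ + 1), 1 / (p : ℝ) ≤
      Real.log (Real.log x) + Real.log (Real.log (Real.log x)) + C := by
  obtain ⟨C, hC⟩ := eventually_tsum_primes_le
  have hl2 : Tendsto (fun x : ℝ => Real.log (Real.log x)) atTop atTop :=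
    Real.tendsto_log_atTop.comp Real.tendsto_log_atTop
  have hs : Tendsto (fun x : ℝ => 1 + (Real.log x * Real.log (Real.log x))⁻¹) atTop (𝓝[>] 1) := by
    refine tendsto_nhdsWithin_iff.mpr ⟨?_, ?_⟩
    · simpa using ((Real.tendsto_log_atTop.atTop_mul_atTop₀ hl2).inv_tendsto_atTop).const_add 1
    · filter_upwards [Real.tendsto_log_atTop.eventually_gt_atTop 0, hl2.eventually_gt_atTop 0]
        with x h1 h2
      simp only [Set.mem_Ioi]
      have : 0 < (Real.log x * Real.log (Real.log x))⁻¹ := by positivity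
      linarith
  refine ⟨2 * |C| + 4, by positivity, ?_⟩
  filter_upwards [hs.eventually hC, hs.eventually self_mem_nhdsWithin, eventually_gt_atTop 1,
    Real.tendsto_log_atTop.eventually_gt_atTop 0, hl2.eventually_ge_atTop 2] with x hx hs hx1 h1 h2
  set l := Real.log x
  set m := Real.log l
  have hs : 1 < 1 + (l * m)⁻¹ := hs
  have hm0 : 0 < m := by linarith
  rw [add_sub_cancel_left, one_div, inv_inv, Real.log_mul h1.ne' hm0.ne'] at hx
  have hx' := (abs_le.1 hx).2
  have hfin : (∑ p ∈ Nat.primesBelow (⌊x⌋₊ + 1), 1 / (p : ℝ)) * (1 - m⁻¹) ≤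
      ∑' p : Nat.Primes, (p : ℝ) ^ (-(1 + (l * m)⁻¹)) := by
    have h := tsum_primes_ite_eq_sum (fun p => 1 / (p : ℝ)) (⌊x⌋₊ + 1)
    rw [← h.tsum_eq, ← tsum_mul_right]
    refine (h.summable.mul_right _).tsum_le_tsum (fun p => ?_) (summable_primes_rpow_neg hs)
    have hp0 : (0 : ℝ) < p := by exact_mod_cast p.2.pos
    split_ifs with hpn
    · have hpx : (p : ℝ) ≤ x := (Nat.le_floor_iff (by linarith)).1 (Nat.lt_succ_iff.1 hpn)
      rw [neg_add, Real.rpow_add hp0, Real.rpow_neg_one, one_div]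
      gcongr
      calc 1 - m⁻¹ ≤ Real.exp (-m⁻¹) := by have := Real.add_one_le_exp (-m⁻¹); linarith
        _ = x ^ (-(l * m)⁻¹) := by
          rw [Real.rpow_def_of_pos (by linarith)]
          congr 1
          change _ = l * _
          field_simp
        _ ≤ _ := Real.rpow_le_rpow_of_nonpos hp0 hpx (by
          have : 0 < (l * m)⁻¹ := by positivity
          linarith)
    · rw [zero_mul]; positivity
  set S := ∑ p ∈ Nat.primesBelow (⌊x⌋₊ + 1), 1 / (p : ℝ)
  have hS : S * (1 - m⁻¹) ≤ m + Real.log m + |C| := by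
    linarith [le_abs_self C]
  have hS0 : 0 ≤ S := Finset.sum_nonneg fun p _ => by positivity
  have hm2 : m⁻¹ ≤ 1 / 2 := by
    rw [inv_le_comm₀ hm0 (by norm_num)]; norm_num; exact h2
  have hmi : 0 < m⁻¹ := by positivity
  have hlm : Real.log m ≤ m := (Real.log_le_sub_one_of_pos hm0).trans (by linarith)
  calc S ≤ S * (1 - m⁻¹) * (1 + 2 * m⁻¹) := by
        have : 0 ≤ S * (m⁻¹ * (1 - 2 * m⁻¹)) := by
          apply mul_nonneg hS0 (mul_nonneg hmi.le (by linarith))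
        nlinarith
    _ ≤ (m + Real.log m + |C|) * (1 + 2 * m⁻¹) := by gcongr
    _ = m + Real.log m + |C| + 2 * (m * m⁻¹) + 2 * (Real.log m * m⁻¹) + |C| * (2 * m⁻¹) := by ring
    _ ≤ m + Real.log m + |C| + 2 * 1 + 2 * 1 + |C| * 1 := by
      gcongr
      · rw [mul_inv_cancel₀ hm0.ne']
      · calc Real.log m * m⁻¹ ≤ m * m⁻¹ := by gcongr
          _ = 1 := mul_inv_cancel₀ hm0.ne'
      · linarith
    _ = _ := by ring

lemma abs_chi_four_le (n : ℕ) : |(ZMod.χ₄ (n : ZMod 4) : ℝ)| ≤ 1 := by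
  generalize (n : ZMod 4) = a
  have : ∀ a : ZMod 4, |ZMod.χ₄ a| ≤ 1 := by decide
  exact_mod_cast this a

open Filter Topology in
/-- A weak lower bound for the sum over primes with weights `2 + χ₄(p)`. -/
lemma sum_primes_chi_ge :
    ∃ C : ℝ, ∀ᶠ z : ℝ in atTop,
      2 * Real.log (Real.log z) - 2 * Real.log (Real.log (Real.log z)) - C ≤
      ∑ p ∈ Nat.primesBelow (⌊z⌋₊ + 1), (2 + (ZMod.χ₄ (p : ZMod 4) : ℝ)) / (p : ℝ) := by
  obtain ⟨C, hC⟩ := eventually_tsum_primes_le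
  obtain ⟨D, hD⟩ := eventually_tsum_primes_chi_ge
  have hl2 : Tendsto (fun x : ℝ => Real.log (Real.log x)) atTop atTop :=
    Real.tendsto_log_atTop.comp Real.tendsto_log_atTop
  have hdiv : Tendsto (fun x : ℝ => Real.log (Real.log x) / Real.log x) atTop (𝓝 0) := by
    have := Real.isLittleO_log_id_atTop.tendsto_div_nhds_zero.comp Real.tendsto_log_atTop
    simpa [Function.comp_def] using this
  have hs : ∀ c : ℝ, 0 < c → Tendsto (fun x : ℝ => 1 + c * (Real.log (Real.log x) / Real.log x))
      atTop (𝓝[>] 1) := by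
    intro c hc
    refine tendsto_nhdsWithin_iff.mpr ⟨?_, ?_⟩
    · simpa using (hdiv.const_mul c).const_add 1
    · filter_upwards [Real.tendsto_log_atTop.eventually_gt_atTop 0, hl2.eventually_gt_atTop 0]
        with x h1 h2
      simp only [Set.mem_Ioi]
      have : 0 < c * (Real.log (Real.log x) / Real.log x) := by positivity
      linarith
  refine ⟨2 * Real.log 2 + 2 * |C| + D + 3 * (1 + |C|), ?_⟩
  filter_upwards [(hs 2 (by norm_num)).eventually hC, (hs 2 (by norm_num)).eventually hD,
    (hs 1 (by norm_num)).eventually hC, eventually_gt_atTop 1,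
    Real.tendsto_log_atTop.eventually_ge_atTop 1, hl2.eventually_ge_atTop 1]
    with z h2C h2D h1C hz hl hm
  set l := Real.log z
  set m := Real.log l
  have hl0 : 0 < l := by linarith
  have hm0 : 0 < m := by linarith
  have hd0 : 0 < m / l := by positivity
  have e1 : Real.log (1 / (1 + 2 * (m / l) - 1)) = m - Real.log m - Real.log 2 := by
    rw [one_div, Real.log_inv, add_sub_cancel_left, Real.log_mul (by norm_num) hd0.ne',
      Real.log_div hm0.ne' hl0.ne']
    ring
  have e2 : Real.log (1 / (1 + 1 * (m / l) - 1)) ≤ l := by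
    rw [one_div, Real.log_inv, add_sub_cancel_left, one_mul, Real.log_div hm0.ne' hl0.ne']
    have := Real.log_nonneg hm
    have h3 : Real.log l ≤ l - 1 := Real.log_le_sub_one_of_pos hl0
    linarith
  rw [e1] at h2C
  have h2C' := (abs_le.1 h2C).1
  have h1C' := (abs_le.1 h1C).2
  have hs2 : 1 < 1 + 2 * (m / l) := by linarith
  have hs1 : 1 < 1 + 1 * (m / l) := by linarith
  have hS2 := summable_primes_rpow_neg hs2
  have hS1 := summable_primes_rpow_neg hs1
  have hSχ : Summable (fun p : Nat.Primes =>
      (ZMod.χ₄ ((p : ℕ) : ZMod 4) : ℝ) * (p : ℝ) ^ (-(1 + 2 * (m / l)))) :=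
    Summable.of_norm_bounded hS2 fun p => by
      rw [norm_mul, Real.norm_of_nonneg (r := (p : ℝ) ^ _) (by positivity)]
      exact mul_le_of_le_one_left (by positivity) (abs_chi_four_le p)
  have h := tsum_primes_ite_eq_sum (fun p => (2 + (ZMod.χ₄ (p : ZMod 4) : ℝ)) / (p : ℝ)) (⌊z⌋₊ + 1)
  have hmain : 2 * ∑' p : Nat.Primes, (p : ℝ) ^ (-(1 + 2 * (m / l))) +
      ∑' p : Nat.Primes, (ZMod.χ₄ ((p : ℕ) : ZMod 4) : ℝ) * (p : ℝ) ^ (-(1 + 2 * (m / l))) ≤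
      ∑ p ∈ Nat.primesBelow (⌊z⌋₊ + 1), (2 + (ZMod.χ₄ (p : ZMod 4) : ℝ)) / (p : ℝ) +
      3 * l⁻¹ * ∑' p : Nat.Primes, (p : ℝ) ^ (-(1 + 1 * (m / l))) := by
    rw [← h.tsum_eq, ← tsum_mul_left, ← tsum_mul_left,
      ← (hS2.mul_left 2).tsum_add hSχ, ← h.summable.tsum_add (hS1.mul_left _)]
    refine ((hS2.mul_left 2).add hSχ).tsum_le_tsum (fun p => ?_)
      (h.summable.add (hS1.mul_left _))
    have hp0 : (0 : ℝ) < p := by exact_mod_cast p.2.pos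
    have hp1 : (1 : ℝ) ≤ p := by exact_mod_cast p.2.one_lt.le
    have hχ := abs_le.1 (abs_chi_four_le p)
    rw [← add_mul]
    split_ifs with hpn
    · have : (2 + (ZMod.χ₄ ((p : ℕ) : ZMod 4) : ℝ)) * (p : ℝ) ^ (-(1 + 2 * (m / l))) ≤
          (2 + (ZMod.χ₄ ((p : ℕ) : ZMod 4) : ℝ)) / (p : ℝ) := by
        rw [div_eq_mul_inv (2 + _), ← Real.rpow_neg_one]
        exact mul_le_mul_of_nonneg_left (Real.rpow_le_rpow_of_exponent_le hp1 (by linarith))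
          (by linarith)
      have h' : 0 ≤ 3 * l⁻¹ * (p : ℝ) ^ (-(1 + 1 * (m / l))) := by positivity
      linarith
    · have hpz : z ≤ p := by
        have := Nat.lt_of_floor_lt (Nat.lt_of_succ_le (not_lt.1 hpn))
        exact this.le
      rw [zero_add, mul_assoc]
      have e : (p : ℝ) ^ (-(1 + 2 * (m / l))) =
          (p : ℝ) ^ (-(m / l)) * (p : ℝ) ^ (-(1 + 1 * (m / l))) := by
        rw [← Real.rpow_add hp0]; congr 1; ring
      rw [e]
      gcongr
      · linarith
      · calc (p : ℝ) ^ (-(m / l)) ≤ z ^ (-(m / l)) :=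
            Real.rpow_le_rpow_of_nonpos (by linarith) hpz (by linarith)
          _ = l⁻¹ := by
            rw [Real.rpow_def_of_pos (by linarith)]
            change Real.exp (l * _) = _
            rw [show l * -(m / l) = -m by field_simp, Real.exp_neg, Real.exp_log hl0]
  have hlast : 3 * l⁻¹ * ∑' p : Nat.Primes, (p : ℝ) ^ (-(1 + 1 * (m / l))) ≤ 3 * (1 + |C|) := by
    calc 3 * l⁻¹ * ∑' p : Nat.Primes, (p : ℝ) ^ (-(1 + 1 * (m / l)))
        ≤ 3 * l⁻¹ * (l + |C| * l) := by
          gcongr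
          have : |C| * 1 ≤ |C| * l := by gcongr
          linarith [le_abs_self C]
      _ = 3 * (1 + |C|) := by field_simp
  linarith [le_abs_self C]

lemma card_filter_range_prod_primes (R : ℕ → Finset ℕ) (D : Finset ℕ)
    (hD : ∀ q ∈ D, q.Prime) (hR : ∀ q ∈ D, R q ⊆ Finset.range q) :
    ((Finset.range (∏ q ∈ D, q)).filter (fun x => ∀ q ∈ D, x % q ∈ R q)).card =
      ∏ q ∈ D, (R q).card := by
  classical
  induction D using Finset.induction_on with
  | empty => simp
  | insert q D hq ih =>
    have hqp : q.Prime := hD q (Finset.mem_insert_self _ _)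
    have hD' : ∀ p ∈ D, p.Prime := fun p hp => hD p (Finset.mem_insert_of_mem hp)
    have hcop : Nat.Coprime q (∏ p ∈ D, p) := Nat.Coprime.prod_right fun p hp =>
      (Nat.coprime_primes hqp (hD' p hp)).2 fun h => hq (h ▸ hp)
    have hP0 : 0 < ∏ p ∈ D, p := Finset.prod_pos fun p hp => (hD' p hp).pos
    rw [Finset.prod_insert hq, Finset.prod_insert hq,
      ← ih hD' fun p hp => hR p (Finset.mem_insert_of_mem hp), ← Finset.card_product]
    have hdvd : ∀ p ∈ D, p ∣ ∏ p ∈ D, p := fun p hp => Finset.dvd_prod_of_mem _ hp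
    refine Finset.card_bij (fun x _ => (x % q, x % ∏ p ∈ D, p)) ?_ ?_ ?_
    · intro x hx
      simp only [Finset.mem_filter, Finset.mem_range, Finset.mem_insert, forall_eq_or_imp,
        Finset.mem_product] at hx ⊢
      refine ⟨hx.2.1, Nat.mod_lt _ hP0, fun p hp => ?_⟩
      rw [Nat.mod_mod_of_dvd _ (hdvd p hp)]
      exact hx.2.2 p hp
    · intro x hx y hy hxy
      simp only [Finset.mem_filter, Finset.mem_range, Prod.mk.injEq] at hx hy hxy
      have : x ≡ y [MOD q * ∏ p ∈ D, p] :=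
        (Nat.modEq_and_modEq_iff_modEq_mul hcop).1 ⟨hxy.1, hxy.2⟩
      exact Nat.ModEq.eq_of_lt_of_lt this hx.1 hy.1
    · rintro ⟨a, b⟩ hab
      simp only [Finset.mem_filter, Finset.mem_range, Finset.mem_product] at hab
      obtain ⟨ha, hb, hb'⟩ := hab
      have haq : a < q := Finset.mem_range.1 (hR q (Finset.mem_insert_self _ _) ha)
      set x := Nat.chineseRemainder hcop a b
      have hx1 : (x : ℕ) % q = a := by
        have := x.2.1
        rwa [Nat.ModEq, Nat.mod_eq_of_lt haq] at this
      have hx2 : (x : ℕ) % ∏ p ∈ D, p = b := by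
        have := x.2.2
        rwa [Nat.ModEq, Nat.mod_eq_of_lt hb] at this
      refine ⟨x, ?_, by simp [hx1, hx2]⟩
      simp only [Finset.mem_filter, Finset.mem_range, Finset.mem_insert, forall_eq_or_imp]
      refine ⟨Nat.chineseRemainder_lt_mul hcop a b hqp.ne_zero hP0.ne', by rwa [hx1],
        fun p hp => ?_⟩
      rw [← Nat.mod_mod_of_dvd _ (hdvd p hp), hx2]
      exact hb' p hp

lemma abs_card_filter_periodic_sub_le (p : ℕ → Prop) [DecidablePred p] {P : ℕ} (hP : 0 < P)
    (hp : Function.Periodic p P) (M : ℕ) :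
    |(((Finset.range M).filter p).card : ℝ) -
      M * ((((Finset.range P).filter p).card : ℝ) / P)| ≤ ((Finset.range P).filter p).card := by
  simp only [← Nat.count_eq_card_filter_range]
  have hk : ∀ k r, Nat.count p (P * k + r) = k * Nat.count p P + Nat.count p r := by
    intro k
    induction k with
    | zero => simp
    | succ k ih =>
      intro r
      rw [show P * (k + 1) + r = P + (P * k + r) by ring, Nat.count_add]
      have : (fun j => p (P + j)) = p := by
        funext j; rw [add_comm]; exact hp j
      simp only [this]
      rw [ih r]; ring
  have hM := hk (M / P) (M % P)
  rw [Nat.div_add_mod] at hM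
  have hr : Nat.count p (M % P) ≤ Nat.count p P := Nat.count_monotone p (Nat.mod_lt _ hP).le
  have hMr : (M : ℝ) = P * (M / P : ℕ) + (M % P : ℕ) := by
    exact_mod_cast (Nat.div_add_mod M P).symm
  have hP' : (0 : ℝ) < P := by exact_mod_cast hP
  set c : ℝ := (Nat.count p P : ℝ)
  have hc : 0 ≤ c := Nat.cast_nonneg _
  have hfrac : ((M % P : ℕ) : ℝ) / P ≤ 1 := by
    rw [div_le_one hP']; exact_mod_cast (Nat.mod_lt _ hP).le
  have e : (Nat.count p M : ℝ) - M * (c / P) =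
      (Nat.count p (M % P) : ℝ) - ((M % P : ℕ) : ℝ) / P * c := by
    rw [hM]
    push_cast
    rw [hMr]
    field_simp
    ring
  rw [e, abs_le]
  have h1 : (Nat.count p (M % P) : ℝ) ≤ c := Nat.cast_le.2 hr
  have h2 : (0 : ℝ) ≤ Nat.count p (M % P) := Nat.cast_nonneg _
  have h3 : 0 ≤ ((M % P : ℕ) : ℝ) / P := by positivity
  constructor <;> nlinarith

/-- Counting the integers below `M` in prescribed residue classes modulo several primes. -/
lemma abs_card_residues_sub_le (R : ℕ → Finset ℕ) (D : Finset ℕ)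
    (hD : ∀ q ∈ D, q.Prime) (hR : ∀ q ∈ D, R q ⊆ Finset.range q) (M : ℕ) :
    |(((Finset.range M).filter (fun x => ∀ q ∈ D, x % q ∈ R q)).card : ℝ) -
      M * ∏ q ∈ D, ((R q).card : ℝ) / q| ≤ ∏ q ∈ D, ((R q).card : ℝ) := by
  have hP0 : 0 < ∏ p ∈ D, p := Finset.prod_pos fun p hp => (hD p hp).pos
  have h := abs_card_filter_periodic_sub_le (fun x => ∀ q ∈ D, x % q ∈ R q) hP0 (by
    intro x
    have : ∀ q ∈ D, (x + ∏ p ∈ D, p) % q = x % q := fun q hq => by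
      obtain ⟨k, hk⟩ := Finset.dvd_prod_of_mem (fun p => p) hq
      rw [hk, Nat.add_mul_mod_self_left]
    simp only [eq_iff_iff]
    exact forall₂_congr fun q hq => by rw [this q hq]) M
  rw [card_filter_range_prod_primes R D hD hR] at h
  push_cast at h
  rwa [← Finset.prod_div_distrib] at h

/-- The Bonferroni inequality: truncating inclusion-exclusion at an even level gives an
upper bound. -/
lemma bonferroni_even (B : Finset ℕ) {r : ℕ} (hr : Even r) :
    (if B = ∅ then (1 : ℝ) else 0) ≤
      ∑ D ∈ B.powerset.filter (fun D => D.card ≤ r), (-1 : ℝ) ^ D.card := by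
  have h : ∑ D ∈ B.powerset.filter (fun D => D.card ≤ r), (-1 : ℝ) ^ D.card =
      ∑ k ∈ Finset.range (r + 1), (-1 : ℝ) ^ k * (B.card.choose k : ℝ) := by
    rw [← Finset.sum_fiberwise_of_maps_to (t := Finset.range (r + 1)) (g := Finset.card)]
    · refine Finset.sum_congr rfl fun k hk => ?_
      rw [Finset.mem_range] at hk
      have : (B.powerset.filter (fun D => D.card ≤ r)).filter (fun D => D.card = k) =
          B.powersetCard k := by
        ext D
        simp only [Finset.mem_filter, Finset.mem_powerset, Finset.mem_powersetCard]
        constructor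
        · rintro ⟨⟨h1, _⟩, h2⟩; exact ⟨h1, h2⟩
        · rintro ⟨h1, h2⟩; exact ⟨⟨h1, by omega⟩, h2⟩
      rw [this, Finset.sum_congr rfl (g := fun _ => (-1 : ℝ) ^ k)
        fun D hD => by rw [(Finset.mem_powersetCard.1 hD).2]]
      rw [Finset.sum_const, Finset.card_powersetCard, nsmul_eq_mul, mul_comm]
    · intro D hD
      simp only [Finset.mem_filter] at hD
      simp only [Finset.mem_range]; omega
  rw [h]
  rcases Finset.eq_empty_or_nonempty B with rfl | hB
  · rw [Finset.sum_eq_single 0]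
    · simp
    · intro k _ hk
      rw [Finset.card_empty, Nat.choose_eq_zero_of_lt (Nat.pos_of_ne_zero hk)]; simp
    · simp
  · rw [if_neg hB.ne_empty]
    obtain ⟨n, hn⟩ := Nat.exists_eq_succ_of_ne_zero hB.card_pos.ne'
    have := Int.alternating_sum_range_choose_eq_choose (n := n) (m := r)
    rw [hr.neg_one_pow, one_mul] at this
    have h2 : ∑ k ∈ Finset.range (r + 1), (-1 : ℝ) ^ k * (B.card.choose k : ℝ) = n.choose r := by
      rw [hn]; exact_mod_cast this
    rw [h2]; positivity

lemma sum_truncated_prod_le (Q : Finset ℕ) {ρ : ℕ → ℝ} (hρ : ∀ q, 0 ≤ ρ q) (r : ℕ) {T : ℝ}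
    (hT1 : 1 ≤ T) (hT : ∑ q ∈ Q, ρ q ≤ T) :
    ∑ D ∈ Q.powerset.filter (fun D => D.card ≤ r), ∏ q ∈ D, ρ q ≤ T ^ r * Real.exp 1 := by
  have hT0 : 0 < T := by linarith
  have e1 : ∑ D ∈ Q.powerset, T ^ r * ∏ q ∈ D, (ρ q / T) ≤ T ^ r * Real.exp 1 := by
    rw [← Finset.mul_sum, ← Finset.prod_one_add]
    refine mul_le_mul_of_nonneg_left ?_ (pow_nonneg hT0.le _)
    calc ∏ q ∈ Q, (1 + ρ q / T) ≤ ∏ q ∈ Q, Real.exp (ρ q / T) :=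
          Finset.prod_le_prod (fun q _ => add_nonneg zero_le_one (div_nonneg (hρ q) hT0.le))
            fun q _ => by rw [add_comm]; exact Real.add_one_le_exp _
      _ = Real.exp ((∑ q ∈ Q, ρ q) / T) := by
          rw [← Real.exp_sum, Finset.sum_div]
      _ ≤ _ := by
          apply Real.exp_le_exp.2
          rwa [div_le_one hT0]
  refine le_trans ?_ e1
  refine (Finset.sum_le_sum fun D hD => ?_).trans
    (Finset.sum_le_sum_of_subset_of_nonneg (Finset.filter_subset _ _) fun D _ _ =>
      mul_nonneg (pow_nonneg hT0.le _) (Finset.prod_nonneg fun q _ => div_nonneg (hρ q) hT0.le))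
  have hDr : D.card ≤ r := (Finset.mem_filter.1 hD).2
  have hp : 0 ≤ ∏ q ∈ D, ρ q := Finset.prod_nonneg fun q _ => hρ q
  rw [Finset.prod_div_distrib, Finset.prod_const, mul_div_assoc', le_div_iff₀ (pow_pos hT0 _),
    mul_comm]
  exact mul_le_mul_of_nonneg_right (pow_le_pow_right₀ hT1 hDr) hp

/-- Brun's pure sieve, with the error terms handled by Rankin's trick. -/
theorem brun_pure_sieve (R : ℕ → Finset ℕ) (Q : Finset ℕ) (hQ : ∀ q ∈ Q, q.Prime)
    (hR : ∀ q ∈ Q, R q ⊆ Finset.range q) (M : ℕ) {r : ℕ} (hr : Even r) {T : ℝ} (hT1 : 1 ≤ T)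
    (hT : ∑ q ∈ Q, ((R q).card : ℝ) ≤ T) :
    (((Finset.range M).filter (fun x => ∀ q ∈ Q, x % q ∉ R q)).card : ℝ) ≤
      M * ∏ q ∈ Q, (1 - ((R q).card : ℝ) / q) +
      M * Real.exp (Real.exp 1 * ∑ q ∈ Q, ((R q).card : ℝ) / q - r) + T ^ r * Real.exp 1 := by
  classical
  set g : ℕ → ℝ := fun q => ((R q).card : ℝ) / q with hg
  have hg0 : ∀ q, 0 ≤ g q := fun q => by positivity
  have hT0 : 0 < T := by linarith
  set Ds := Q.powerset.filter (fun D => D.card ≤ r) with hDs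
  have step1 : (((Finset.range M).filter (fun x => ∀ q ∈ Q, x % q ∉ R q)).card : ℝ) ≤
      ∑ D ∈ Ds, (-1 : ℝ) ^ D.card *
        ((Finset.range M).filter (fun x => ∀ q ∈ D, x % q ∈ R q)).card := by
    have e : ∀ D ∈ Ds, (-1 : ℝ) ^ D.card *
        (((Finset.range M).filter (fun x => ∀ q ∈ D, x % q ∈ R q)).card : ℝ) =
        ∑ x ∈ Finset.range M, if ∀ q ∈ D, x % q ∈ R q then (-1 : ℝ) ^ D.card else 0 := by
      intro D _
      rw [← Finset.sum_filter, Finset.sum_const, nsmul_eq_mul, mul_comm]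
    rw [Finset.sum_congr rfl e, Finset.sum_comm, Finset.card_filter]
    push_cast
    refine Finset.sum_le_sum fun x _ => ?_
    have hB := bonferroni_even (Q.filter fun q => x % q ∈ R q) hr
    rw [← Finset.sum_filter]
    have hif : (if ∀ q ∈ Q, x % q ∉ R q then (1 : ℝ) else 0) =
        if Q.filter (fun q => x % q ∈ R q) = ∅ then 1 else 0 := by
      simp only [Finset.filter_eq_empty_iff]
    have hfil : Ds.filter (fun D => ∀ q ∈ D, x % q ∈ R q) =
        (Q.filter fun q => x % q ∈ R q).powerset.filter (fun D => D.card ≤ r) := by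
      ext D
      simp only [hDs, Finset.mem_filter, Finset.mem_powerset, Finset.subset_iff]
      constructor
      · rintro ⟨⟨h1, h2⟩, h3⟩; exact ⟨fun q hq => ⟨h1 hq, h3 q hq⟩, h2⟩
      · rintro ⟨h1, h2⟩; exact ⟨⟨fun q hq => (h1 hq).1, h2⟩, fun q hq => (h1 hq).2⟩
    rw [hif, hfil]
    exact hB
  have step2 : ∑ D ∈ Ds, (-1 : ℝ) ^ D.card *
        (((Finset.range M).filter (fun x => ∀ q ∈ D, x % q ∈ R q)).card : ℝ) ≤
      M * ∑ D ∈ Ds, ∏ q ∈ D, (-g q) + ∑ D ∈ Ds, ∏ q ∈ D, ((R q).card : ℝ) := by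
    rw [Finset.mul_sum, ← Finset.sum_add_distrib]
    refine Finset.sum_le_sum fun D hD => ?_
    have hDQ : D ⊆ Q := Finset.mem_powerset.1 (Finset.mem_filter.1 hD).1
    have h := abs_card_residues_sub_le R D (fun q hq => hQ q (hDQ hq))
      (fun q hq => hR q (hDQ hq)) M
    rw [Finset.prod_neg]
    have h2 : ((-1 : ℝ) ^ D.card) * ((((Finset.range M).filter
        (fun x => ∀ q ∈ D, x % q ∈ R q)).card : ℝ) - M * ∏ q ∈ D, ((R q).card : ℝ) / q) ≤
        ∏ q ∈ D, ((R q).card : ℝ) := by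
      refine (le_abs_self _).trans ?_
      rwa [abs_mul, abs_pow, abs_neg, abs_one, one_pow, one_mul]
    simp only [hg]
    linarith
  have step3 : ∑ D ∈ Ds, ∏ q ∈ D, (-g q) ≤
      ∏ q ∈ Q, (1 - g q) + Real.exp (Real.exp 1 * ∑ q ∈ Q, g q - r) := by
    have e1 : ∏ q ∈ Q, (1 - g q) = ∑ D ∈ Q.powerset, ∏ q ∈ D, (-g q) := by
      rw [← Finset.prod_one_add]; simp only [sub_eq_add_neg]
    rw [e1, ← Finset.sum_filter_add_sum_filter_not Q.powerset (fun D => D.card ≤ r), add_assoc]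
    refine le_add_of_nonneg_right ?_
    have e2 : Real.exp (Real.exp 1 * ∑ q ∈ Q, g q - r) ≥
        ∑ D ∈ Q.powerset, Real.exp (-r) * ∏ q ∈ D, (Real.exp 1 * g q) := by
      rw [← Finset.mul_sum, ← Finset.prod_one_add, sub_eq_neg_add, Real.exp_add, Finset.mul_sum,
        Real.exp_sum]
      gcongr with q hq
      · rw [add_comm]; exact Real.add_one_le_exp _
    have e3 : -∑ D ∈ Q.powerset.filter (fun D => ¬ D.card ≤ r), ∏ q ∈ D, (-g q) ≤
        ∑ D ∈ Q.powerset, Real.exp (-r) * ∏ q ∈ D, (Real.exp 1 * g q) := by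
      rw [← Finset.sum_neg_distrib]
      refine (Finset.sum_le_sum fun D hD => ?_).trans
        (Finset.sum_le_sum_of_subset_of_nonneg (Finset.filter_subset _ _) fun D _ _ =>
          mul_nonneg (Real.exp_pos _).le (Finset.prod_nonneg fun q _ =>
            mul_nonneg (Real.exp_pos _).le (hg0 q)))
      have hDr : r ≤ D.card := (not_le.1 (Finset.mem_filter.1 hD).2).le
      rw [Finset.prod_mul_distrib, Finset.prod_const, ← mul_assoc, ← Real.exp_nat_mul,
        ← Real.exp_add]
      have hp : 0 ≤ ∏ q ∈ D, g q := Finset.prod_nonneg fun q _ => hg0 q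
      refine (neg_le_abs _).trans ?_
      rw [Finset.abs_prod]
      simp only [abs_neg, abs_of_nonneg (hg0 _)]
      refine le_mul_of_one_le_left hp (Real.one_le_exp ?_)
      have : (r : ℝ) ≤ D.card := by exact_mod_cast hDr
      linarith
    linarith
  have step4 : ∑ D ∈ Ds, ∏ q ∈ D, ((R q).card : ℝ) ≤ T ^ r * Real.exp 1 :=
    sum_truncated_prod_le Q (fun _ => Nat.cast_nonneg _) r hT1 hT
  have hM0 : (0 : ℝ) ≤ M := Nat.cast_nonneg _
  have := mul_le_mul_of_nonneg_left step3 hM0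
  rw [mul_add] at this
  linarith

lemma exists_residues {q c b : ℕ} (hq : q.Prime) (hq2 : q ≠ 2) (hc : ¬ q ∣ c) (hb : ¬ q ∣ b) :
    ∃ R : Finset ℕ, R ⊆ Finset.range q ∧ (R.card : ℝ) = 2 + (ZMod.χ₄ (q : ZMod 4) : ℝ) ∧
      ∀ x : ℕ, x % q ∈ R → q ∣ x * ((x * c) ^ 2 + b ^ 2) := by
  have : Fact q.Prime := ⟨hq⟩
  have hodd : q % 2 = 1 := hq.eq_two_or_odd.resolve_left hq2
  have hcz : (c : ZMod q) ≠ 0 := by rwa [Ne, ZMod.natCast_eq_zero_iff]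
  have hbz : (b : ZMod q) ≠ 0 := by rwa [Ne, ZMod.natCast_eq_zero_iff]
  have h4 : q % 4 = 1 ∨ q % 4 = 3 := by omega
  rcases h4 with h4 | h4
  · obtain ⟨i, hi⟩ := ZMod.exists_sq_eq_neg_one_iff.2 (show q % 4 ≠ 3 by omega)
    have hi0 : i ≠ 0 := by rintro rfl; simp at hi
    set u : ZMod q := i * b / c with hu
    have hu0 : u ≠ 0 := div_ne_zero (mul_ne_zero hi0 hbz) hcz
    have hun : u ≠ -u := fun h => hu0 (by
      have h2 : (2 : ZMod q) ≠ 0 := by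
        have : ((2 : ℕ) : ZMod q) ≠ 0 := by
          rw [Ne, ZMod.natCast_eq_zero_iff, Nat.prime_dvd_prime_iff_eq hq Nat.prime_two]
          exact hq2
        exact_mod_cast this
      have : 2 * u = 0 := by linear_combination h
      exact (mul_eq_zero.1 this).resolve_left h2)
    have huc : u * c = i * b := div_mul_cancel₀ _ hcz
    refine ⟨({0, u, -u} : Finset (ZMod q)).image ZMod.val, ?_, ?_, ?_⟩
    · intro x hx
      obtain ⟨y, _, rfl⟩ := Finset.mem_image.1 hx
      exact Finset.mem_range.2 (ZMod.val_lt y)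
    · rw [Finset.card_image_of_injective _ (ZMod.val_injective q),
        Finset.card_eq_three.2 ⟨0, u, -u, hu0.symm, by simpa using hu0, hun, rfl⟩,
        ZMod.χ₄_nat_one_mod_four h4]
      norm_num
    · intro x hx
      obtain ⟨y, hy, hyx⟩ := Finset.mem_image.1 hx
      have hyx : (x : ZMod q) = y := by
        rw [← ZMod.natCast_zmod_val y, hyx, ZMod.natCast_mod]
      rw [← ZMod.natCast_eq_zero_iff]
      push_cast
      rw [hyx]
      simp only [Finset.mem_insert, Finset.mem_singleton] at hy
      rcases hy with rfl | rfl | rfl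
      · simp
      · rw [huc]; linear_combination -(u * b ^ 2) * hi
      · have h2 : (-u * c) ^ 2 = (i * b) ^ 2 := by rw [neg_mul, huc]; ring
        rw [h2]; linear_combination (u * b ^ 2) * hi
  · refine ⟨{0}, by simpa using hq.pos, ?_, ?_⟩
    · rw [ZMod.χ₄_nat_three_mod_four h4]; norm_num
    · intro x hx
      exact (Nat.dvd_of_mod_eq_zero (by simpa using hx)).mul_right _

/-- The primes `p ∈ (Y, X]` with `(p c)² + b²` prime. -/
noncomputable def sumSqPrimes (c b : ℕ) (Y X : ℝ) : Finset ℕ :=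
  (Finset.range (⌊X⌋₊ + 1)).filter
    (fun p => p.Prime ∧ Y < p ∧ ((p * c) ^ 2 + b ^ 2).Prime)

/-- The factor by which the sieve bound can increase because of the primes dividing `m`. -/
noncomputable def sieveFactor (m : ℕ) : ℝ := ∏ q ∈ m.primeFactors, (1 + 8 / (q : ℝ))

lemma one_le_sieveFactor (m : ℕ) : 1 ≤ sieveFactor m :=
  Finset.one_le_prod fun q _ => by
    have : (0 : ℝ) ≤ 8 / (q : ℝ) := by positivity
    linarith

lemma prod_sieve_density_le (P : Finset ℕ) {g : ℕ → ℝ} (hg : ∀ q, g q ≤ 3)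
    (hP : ∀ q ∈ P, q.Prime ∧ 5 ≤ q) {m : ℕ} (hm : m ≠ 0) :
    ∏ q ∈ P.filter (fun q => ¬ q ∣ m), (1 - g q / q) ≤
      Real.exp (-∑ q ∈ P, g q / q) * sieveFactor m := by
  have hpos : ∀ q ∈ P, 0 < 1 - g q / q := fun q hq => by
    have h5 : (5 : ℝ) ≤ q := by exact_mod_cast (hP q hq).2
    rw [sub_pos, div_lt_one (by linarith)]
    linarith [hg q]
  have h1 : ∀ q ∈ P, 1 ≤ (1 - g q / q) * (1 + 8 / (q : ℝ)) := fun q hq => by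
    have h5 : (5 : ℝ) ≤ q := by exact_mod_cast (hP q hq).2
    have hq0 : (0 : ℝ) < q := by linarith
    have h3 : 1 - 3 / (q : ℝ) ≤ 1 - g q / q := by
      have := hg q
      gcongr
    calc (1 : ℝ) ≤ (1 - 3 / (q : ℝ)) * (1 + 8 / (q : ℝ)) := by
          have : (1 - 3 / (q : ℝ)) * (1 + 8 / (q : ℝ)) = 1 + (5 * q - 24) / q ^ 2 := by
            field_simp; ring
          rw [this]
          have : 0 ≤ (5 * (q : ℝ) - 24) / q ^ 2 := div_nonneg (by linarith) (by positivity)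
          linarith
      _ ≤ _ := by gcongr
  have h2 : ∏ q ∈ P, (1 - g q / q) ≤ Real.exp (-∑ q ∈ P, g q / q) := by
    rw [← Finset.sum_neg_distrib, Real.exp_sum]
    exact Finset.prod_le_prod (fun q hq => (hpos q hq).le) fun q _ => by
      have := Real.add_one_le_exp (-(g q / q)); linarith
  have h3 : ∏ q ∈ P.filter (fun q => q ∣ m), (1 + 8 / (q : ℝ)) ≤ sieveFactor m := by
    unfold sieveFactor
    refine Finset.prod_le_prod_of_subset_of_one_le ?_ ?_ ?_
    · intro q hq
      rw [Finset.mem_filter] at hq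
      exact Nat.mem_primeFactors.2 ⟨(hP q hq.1).1, hq.2, hm⟩
    · intro q _; positivity
    · intro q _ _
      have : (0 : ℝ) ≤ 8 / (q : ℝ) := by positivity
      linarith
  have hA : 0 ≤ ∏ q ∈ P.filter (fun q => ¬ q ∣ m), (1 - g q / q) :=
    Finset.prod_nonneg fun q hq => (hpos q (Finset.mem_filter.1 hq).1).le
  have hfull : 0 ≤ ∏ q ∈ P, (1 - g q / q) := Finset.prod_nonneg fun q hq => (hpos q hq).le
  have h4 : 1 ≤ ∏ q ∈ P.filter (fun q => q ∣ m), ((1 - g q / q) * (1 + 8 / (q : ℝ))) :=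
    Finset.one_le_prod fun q hq => h1 q (Finset.mem_filter.1 hq).1
  calc _ ≤ (∏ q ∈ P.filter (fun q => ¬ q ∣ m), (1 - g q / q)) *
        ∏ q ∈ P.filter (fun q => q ∣ m), ((1 - g q / q) * (1 + 8 / (q : ℝ))) :=
        le_mul_of_one_le_right hA h4
    _ = (∏ q ∈ P, (1 - g q / q)) * ∏ q ∈ P.filter (fun q => q ∣ m), (1 + 8 / (q : ℝ)) := by
        rw [Finset.prod_mul_distrib, ← mul_assoc, mul_comm (∏ q ∈ P.filter (fun q => ¬ q ∣ m), _),
          Finset.prod_filter_mul_prod_filter_not]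
    _ ≤ (∏ q ∈ P, (1 - g q / q)) * sieveFactor m := mul_le_mul_of_nonneg_left h3 hfull
    _ ≤ _ := mul_le_mul_of_nonneg_right h2 (zero_le_one.trans (one_le_sieveFactor m))

lemma card_sumSqPrimes_le {c b : ℕ} (hc : 0 < c) (hb : 0 < b) {z Y X : ℝ} (hz : 1 ≤ z)
    (hzY : z ≤ Y) (hX : 1 ≤ X) {r : ℕ} (hr : Even r) :
    ((sumSqPrimes c b Y X).card : ℝ) ≤
      2 * X * (Real.exp (2 - ∑ q ∈ Nat.primesBelow (⌊z⌋₊ + 1),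
        (2 + (ZMod.χ₄ (q : ZMod 4) : ℝ)) / (q : ℝ)) * sieveFactor (c * b)) +
      2 * X * Real.exp (3 * Real.exp 1 * ∑ q ∈ Nat.primesBelow (⌊z⌋₊ + 1), 1 / (q : ℝ) - r) +
      (3 * z) ^ r * Real.exp 1 := by
  classical
  set g : ℕ → ℝ := fun q => 2 + (ZMod.χ₄ (q : ZMod 4) : ℝ) with hg
  have hg3 : ∀ q, g q ≤ 3 := fun q => by
    have := (abs_le.1 (abs_chi_four_le q)).2; simp only [hg]; linarith
  have hg1 : ∀ q, 1 ≤ g q := fun q => by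
    have := (abs_le.1 (abs_chi_four_le q)).1; simp only [hg]; linarith
  set P := (Nat.primesBelow (⌊z⌋₊ + 1)).filter (fun q => 5 ≤ q) with hP
  have hPp : ∀ q ∈ P, q.Prime ∧ 5 ≤ q := fun q hq => by
    rw [hP, Finset.mem_filter, Nat.mem_primesBelow] at hq
    exact ⟨hq.1.2, hq.2⟩
  set Q := P.filter (fun q => ¬ q ∣ c * b) with hQ
  have hQP : ∀ q ∈ Q, q ∈ P := fun q hq => (Finset.mem_filter.1 hq).1
  have hQz : ∀ q ∈ Q, (q : ℝ) ≤ z := fun q hq => by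
    have := (Nat.mem_primesBelow.1 (Finset.mem_filter.1 (hQP q hq)).1).1
    exact (Nat.le_floor_iff (by linarith)).1 (Nat.lt_succ_iff.1 this)
  have hex : ∀ q : ℕ, ∃ R : Finset ℕ, q ∈ Q → R ⊆ Finset.range q ∧ (R.card : ℝ) = g q ∧
      ∀ x : ℕ, x % q ∈ R → q ∣ x * ((x * c) ^ 2 + b ^ 2) := by
    intro q
    by_cases hq : q ∈ Q
    · have hq1 := hPp q (hQP q hq)
      have hq2 := (Finset.mem_filter.1 hq).2
      obtain ⟨R, hR⟩ := exists_residues hq1.1 (by omega) (fun h => hq2 (h.mul_right b))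
        (fun h => hq2 (h.mul_left c))
      exact ⟨R, fun _ => hR⟩
    · exact ⟨∅, fun h => absurd h hq⟩
  choose R hR using hex
  have hsub : sumSqPrimes c b Y X ⊆
      (Finset.range (⌊X⌋₊ + 1)).filter (fun x => ∀ q ∈ Q, x % q ∉ R q) := by
    intro p hp
    rw [sumSqPrimes, Finset.mem_filter] at hp
    obtain ⟨hp1, hp2, hp3, hp4⟩ := hp
    refine Finset.mem_filter.2 ⟨hp1, fun q hq hpq => ?_⟩
    have hd := (hR q hq).2.2 p hpq
    have hqp := (hPp q (hQP q hq)).1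
    have hlt : q < p := by
      have : (q : ℝ) < p := (hQz q hq).trans_lt (hzY.trans_lt hp3)
      exact_mod_cast this
    rcases hqp.dvd_mul.1 hd with h | h
    · exact hlt.ne ((Nat.prime_dvd_prime_iff_eq hqp hp2).1 h)
    · have h2 := (Nat.prime_dvd_prime_iff_eq hqp hp4).1 h
      have : p ≤ (p * c) ^ 2 := by
        calc p ≤ p * c := Nat.le_mul_of_pos_right _ hc
          _ ≤ (p * c) ^ 2 := Nat.le_self_pow two_ne_zero _
      omega
  have hcardQ : ((Q.card : ℕ) : ℝ) ≤ z := by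
    have h1 : Q ⊆ Finset.Icc 1 ⌊z⌋₊ := fun q hq => by
      rw [Finset.mem_Icc]
      exact ⟨(hPp q (hQP q hq)).1.one_lt.le, Nat.le_floor (hQz q hq)⟩
    have h2 := Finset.card_le_card h1
    rw [Nat.card_Icc, Nat.add_sub_cancel] at h2
    exact (Nat.cast_le.2 h2).trans (Nat.floor_le (by linarith))
  have hsumR : ∑ q ∈ Q, ((R q).card : ℝ) ≤ 3 * z := by
    calc ∑ q ∈ Q, ((R q).card : ℝ) ≤ ∑ q ∈ Q, (3 : ℝ) :=
          Finset.sum_le_sum fun q hq => by rw [(hR q hq).2.1]; exact hg3 q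
      _ = 3 * Q.card := by rw [Finset.sum_const, nsmul_eq_mul, mul_comm]
      _ ≤ _ := by linarith
  have hbrun := brun_pure_sieve R Q (fun q hq => (hPp q (hQP q hq)).1) (fun q hq => (hR q hq).1)
    (⌊X⌋₊ + 1) hr (by linarith : 1 ≤ 3 * z) hsumR
  have hprod : ∏ q ∈ Q, (1 - ((R q).card : ℝ) / q) = ∏ q ∈ Q, (1 - g q / q) :=
    Finset.prod_congr rfl fun q hq => by rw [(hR q hq).2.1]
  have hsum : ∑ q ∈ Q, ((R q).card : ℝ) / q ≤
      3 * ∑ q ∈ Nat.primesBelow (⌊z⌋₊ + 1), 1 / (q : ℝ) := by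
    rw [Finset.mul_sum]
    calc ∑ q ∈ Q, ((R q).card : ℝ) / q ≤ ∑ q ∈ Q, 3 * (1 / (q : ℝ)) :=
          Finset.sum_le_sum fun q hq => by
            rw [(hR q hq).2.1, mul_one_div]
            exact div_le_div_of_nonneg_right (hg3 q) (Nat.cast_nonneg _)
      _ ≤ _ := Finset.sum_le_sum_of_subset_of_nonneg
          ((Finset.filter_subset _ _).trans (Finset.filter_subset _ _))
          fun q _ _ => by positivity
  have hPsum : ∑ q ∈ Nat.primesBelow (⌊z⌋₊ + 1), g q / (q : ℝ) ≤ 2 + ∑ q ∈ P, g q / q := by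
    rw [← Finset.sum_filter_add_sum_filter_not (Nat.primesBelow (⌊z⌋₊ + 1)) (fun q => 5 ≤ q),
      add_comm]
    gcongr
    have hs : (Nat.primesBelow (⌊z⌋₊ + 1)).filter (fun q => ¬ 5 ≤ q) ⊆ {2, 3} := by
      intro q hq
      rw [Finset.mem_filter, Nat.mem_primesBelow] at hq
      obtain ⟨⟨_, h1⟩, h2⟩ := hq
      have := h1.two_le
      interval_cases q <;> first | (simp; done) | exact absurd h1 (by decide)
    refine (Finset.sum_le_sum_of_subset_of_nonneg hs fun q _ _ =>
      div_nonneg (by linarith [hg1 q]) (Nat.cast_nonneg _)).trans ?_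
    rw [Finset.sum_pair (by norm_num)]
    have h2 : g 2 = 2 := by
      simp only [hg]
      rw [show ((2 : ℕ) : ZMod 4) = 2 from rfl, show ZMod.χ₄ 2 = 0 by decide]
      norm_num
    have h3 : g 3 ≤ 3 := hg3 3
    rw [h2]
    push_cast
    linarith
  have hdens := prod_sieve_density_le P hg3 hPp (mul_ne_zero hc.ne' hb.ne')
  have hM : ((⌊X⌋₊ + 1 : ℕ) : ℝ) ≤ 2 * X := by
    push_cast
    linarith [Nat.floor_le (by linarith : 0 ≤ X)]
  have hsf := one_le_sieveFactor (c * b)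
  calc ((sumSqPrimes c b Y X).card : ℝ) ≤ _ := by exact_mod_cast Finset.card_le_card hsub
    _ ≤ _ := hbrun
    _ ≤ _ := by
      rw [hprod]
      have hd2 : ∏ q ∈ Q, (1 - g q / q) ≤ Real.exp (2 - ∑ q ∈ Nat.primesBelow (⌊z⌋₊ + 1),
          g q / (q : ℝ)) * sieveFactor (c * b) := by
        refine hdens.trans (mul_le_mul_of_nonneg_right (Real.exp_le_exp.2 ?_) (by linarith))
        linarith
      have he : Real.exp (Real.exp 1 * ∑ q ∈ Q, ((R q).card : ℝ) / q - r) ≤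
          Real.exp (3 * Real.exp 1 * ∑ q ∈ Nat.primesBelow (⌊z⌋₊ + 1), 1 / (q : ℝ) - r) := by
        apply Real.exp_le_exp.2
        have := mul_le_mul_of_nonneg_left hsum (Real.exp_pos 1).le
        linarith
      have t1 : ((⌊X⌋₊ + 1 : ℕ) : ℝ) * ∏ q ∈ Q, (1 - g q / q) ≤
          2 * X * (Real.exp (2 - ∑ q ∈ Nat.primesBelow (⌊z⌋₊ + 1),
          g q / (q : ℝ)) * sieveFactor (c * b)) := by
        refine (mul_le_mul_of_nonneg_left hd2 (Nat.cast_nonneg _)).trans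
          (mul_le_mul_of_nonneg_right hM ?_)
        have := Real.exp_pos (2 - ∑ q ∈ Nat.primesBelow (⌊z⌋₊ + 1), g q / (q : ℝ))
        exact mul_nonneg this.le (by linarith)
      have t2 := mul_le_mul hM he (Real.exp_pos _).le (by linarith)
      linarith

lemma exists_card_sumSqPrimes_le : ∃ C : ℝ, 0 ≤ C ∧ ∀ᶠ t : ℝ in Filter.atTop,
    ∀ (c b : ℕ), 0 < c → 0 < b → ∀ X : ℝ, Real.exp (Real.exp t / t) ≤ X →
      ((sumSqPrimes c b (Real.exp (Real.exp t / t)) X).card : ℝ) ≤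
        C * X * sieveFactor (c * b) * t ^ 6 * Real.exp (-2 * t) := by
  obtain ⟨C₂, hC₂, h2⟩ := sum_primes_inv_le
  obtain ⟨C₁, h1⟩ := sum_primes_chi_ge
  have hlog : Filter.Tendsto (fun t : ℝ => Real.exp t / (48 * t ^ 2)) Filter.atTop Filter.atTop := by
    have h := (Real.tendsto_exp_div_pow_atTop 2).const_mul_atTop (show (0 : ℝ) < 1 / 48 by norm_num)
    refine h.congr fun t => ?_
    rw [div_mul_div_comm, one_mul]
  have hz := Real.tendsto_exp_atTop.comp hlog
  have hll := Real.tendsto_log_atTop.comp hlog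
  refine ⟨2 * Real.exp (2 + C₁ + 2 * Real.log 48) + 2 * Real.exp (9 * C₂) + 1, by positivity, ?_⟩
  filter_upwards [hz.eventually h2, hz.eventually h1, hll.eventually_gt_atTop 0,
    Filter.eventually_ge_atTop 1, (Real.tendsto_exp_div_pow_atTop 2).eventually_ge_atTop 94]
    with t ht2 ht1 hll0 htone h94 c b hc hb X hX
  have ht0 : 0 < t := by linarith
  simp only [Function.comp_apply, Real.log_exp] at ht1 ht2 hll0
  set z := Real.exp (Real.exp t / (48 * t ^ 2)) with hzdef
  have hloglog : Real.log (Real.exp t / (48 * t ^ 2)) = t - Real.log 48 - 2 * Real.log t := by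
    rw [Real.log_div (Real.exp_pos t).ne' (by positivity), Real.log_exp,
      Real.log_mul (by norm_num) (by positivity), Real.log_pow]
    push_cast; ring
  have hlog48 : 0 ≤ Real.log 48 := Real.log_nonneg (by norm_num)
  have hlogt : 0 ≤ Real.log t := Real.log_nonneg htone
  have hlogt' : Real.log t ≤ t := (Real.log_le_sub_one_of_pos ht0).trans (by linarith)
  have hlll : Real.log (Real.log (Real.exp t / (48 * t ^ 2))) ≤ Real.log t :=
    Real.log_le_log hll0 (by rw [hloglog]; linarith)
  have h94' : 94 * t ^ 2 ≤ Real.exp t := (le_div_iff₀ (by positivity)).1 h94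
  have hz1 : 1 ≤ z := Real.one_le_exp (by positivity)
  have hzY : z ≤ Real.exp (Real.exp t / t) := by
    apply Real.exp_le_exp.2
    apply div_le_div_of_nonneg_left (Real.exp_pos t).le ht0
    nlinarith
  have hX1 : 1 ≤ X := (Real.one_le_exp (by positivity)).trans hX
  set r := 2 * ⌈10 * t⌉₊ with hr
  have hr1 : 20 * t ≤ r := by
    have := Nat.le_ceil (10 * t)
    rw [hr]; push_cast; linarith
  have hr2 : (r : ℝ) ≤ 22 * t := by
    have := (Nat.ceil_lt_add_one (by positivity : 0 ≤ 10 * t)).le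
    rw [hr]; push_cast; linarith
  have key := card_sumSqPrimes_le hc hb hz1 hzY hX1 (even_two_mul ⌈10 * t⌉₊)
  rw [← hr] at key
  have hs := one_le_sieveFactor (c * b)
  set s := sieveFactor (c * b)
  set E := Real.exp (-2 * t) with hE
  have hE0 : 0 < E := Real.exp_pos _
  have e1 : Real.exp (2 - ∑ q ∈ Nat.primesBelow (⌊z⌋₊ + 1),
      (2 + (ZMod.χ₄ (q : ZMod 4) : ℝ)) / (q : ℝ)) ≤
      Real.exp (2 + C₁ + 2 * Real.log 48) * (t ^ 6 * E) := by
    have : t ^ 6 = Real.exp (6 * Real.log t) := by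
      rw [mul_comm, Real.exp_mul, Real.exp_log ht0]; norm_cast
    rw [this, hE, ← Real.exp_add, ← Real.exp_add]
    apply Real.exp_le_exp.2
    rw [hloglog] at ht1 hlll
    linarith
  have e2 : Real.exp (3 * Real.exp 1 * ∑ q ∈ Nat.primesBelow (⌊z⌋₊ + 1), 1 / (q : ℝ) - r) ≤
      Real.exp (9 * C₂) * E := by
    rw [hE, ← Real.exp_add]
    apply Real.exp_le_exp.2
    have h3 : Real.exp 1 ≤ 3 := by linarith [Real.exp_one_lt_d9]
    have hS0 : 0 ≤ ∑ q ∈ Nat.primesBelow (⌊z⌋₊ + 1), 1 / (q : ℝ) :=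
      Finset.sum_nonneg fun q _ => by positivity
    have hS : ∑ q ∈ Nat.primesBelow (⌊z⌋₊ + 1), 1 / (q : ℝ) ≤ 2 * t + C₂ := by
      rw [hloglog] at ht2 hlll
      linarith
    have := mul_le_mul_of_nonneg_right h3 hS0
    linarith
  have e3 : (3 * z) ^ r * Real.exp 1 ≤ X * E := by
    have h3 : (3 : ℝ) ≤ Real.exp 2 := by
      have := Real.add_one_le_exp (2 : ℝ); linarith
    calc (3 * z) ^ r * Real.exp 1 ≤ (Real.exp 2 * z) ^ r * Real.exp 1 := by gcongr
      _ = Real.exp (r * (2 + Real.exp t / (48 * t ^ 2)) + 1) := by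
        rw [hzdef, ← Real.exp_add, ← Real.exp_nat_mul, ← Real.exp_add]
      _ ≤ Real.exp (Real.exp t / t + -2 * t) := by
        apply Real.exp_le_exp.2
        have h5 : r * (2 + Real.exp t / (48 * t ^ 2)) ≤ 22 * t * (2 + Real.exp t / (48 * t ^ 2)) := by
          gcongr
        have h6 : 22 * t * (2 + Real.exp t / (48 * t ^ 2)) = 44 * t + 11 / 24 * (Real.exp t / t) := by
          field_simp; ring
        have h7 : 94 * t ≤ Real.exp t / t := by
          rw [le_div_iff₀ ht0]; linarith
        linarith
      _ = Real.exp (Real.exp t / t) * E := by rw [Real.exp_add]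
      _ ≤ _ := by gcongr
  have ht6 : 1 ≤ t ^ 6 := one_le_pow₀ htone
  have hst : 1 ≤ s * t ^ 6 := one_le_mul_of_one_le_of_one_le hs ht6
  refine key.trans ?_
  have f1 := mul_le_mul_of_nonneg_left (mul_le_mul_of_nonneg_right e1 (by linarith : 0 ≤ s))
    (by linarith : 0 ≤ 2 * X)
  have f2 := mul_le_mul_of_nonneg_left e2 (by linarith : 0 ≤ 2 * X)
  have hB : 0 ≤ (2 * X * (Real.exp (9 * C₂) * E) + X * E) :=
    by positivity
  have f3 := le_mul_of_one_le_right hB hst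
  linarith

/-- The multiplicative weight `m ↦ m⁻¹ ∏_{q ∣ m} β (1 + 8 / q)`. -/
noncomputable def sieveWeight (β : ℝ) (m : ℕ) : ℝ :=
  (∏ q ∈ m.primeFactors, β * (1 + 8 / (q : ℝ))) / m

lemma sieveWeight_nonneg {β : ℝ} (hβ : 0 ≤ β) (m : ℕ) : 0 ≤ sieveWeight β m :=
  div_nonneg (Finset.prod_nonneg fun q _ => by positivity) (Nat.cast_nonneg m)

lemma sieveWeight_one (β : ℝ) : sieveWeight β 1 = 1 := by simp [sieveWeight]

lemma sieveWeight_mul (β : ℝ) {m n : ℕ} (h : m.Coprime n) :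
    sieveWeight β (m * n) = sieveWeight β m * sieveWeight β n := by
  unfold sieveWeight
  rw [h.primeFactors_mul, Finset.prod_union h.disjoint_primeFactors, Nat.cast_mul,
    div_mul_div_comm]

lemma sieveWeight_eq (β : ℝ) (m : ℕ) :
    sieveWeight β m = β ^ m.primeFactors.card * sieveFactor m / m := by
  rw [sieveWeight, Finset.prod_mul_distrib, Finset.prod_const, sieveFactor]

lemma hasSum_sieveWeight_pow (β : ℝ) {p : ℕ} (hp : p.Prime) :
    HasSum (fun n : ℕ => sieveWeight β (p ^ n)) (1 + β * (1 + 8 / (p : ℝ)) / (p - 1)) := by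
  have hp1 : (1 : ℝ) < p := by exact_mod_cast hp.one_lt
  have hp0 : (0 : ℝ) < p := by linarith
  have hpm : (p : ℝ) - 1 ≠ 0 := by linarith
  have h := (hasSum_geometric_of_lt_one (inv_nonneg.2 hp0.le)
    (inv_lt_one_of_one_lt₀ hp1)).mul_left (β * (1 + 8 / (p : ℝ)) / p)
  have h1 : HasSum (fun n : ℕ => sieveWeight β (p ^ (n + 1)))
      (β * (1 + 8 / (p : ℝ)) / (p - 1)) := by
    have hf : (fun n : ℕ => sieveWeight β (p ^ (n + 1))) =
        fun n => β * (1 + 8 / (p : ℝ)) / p * (p : ℝ)⁻¹ ^ n := by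
      funext n
      rw [sieveWeight, Nat.primeFactors_pow _ n.succ_ne_zero, hp.primeFactors,
        Finset.prod_singleton, inv_pow, Nat.cast_pow, pow_succ]
      field_simp
    have hv : β * (1 + 8 / (p : ℝ)) / (p - 1) =
        β * (1 + 8 / (p : ℝ)) / p * (1 - (p : ℝ)⁻¹)⁻¹ := by
      field_simp
    rw [hf, hv]
    exact h
  have h2 := (hasSum_nat_add_iff (f := fun n : ℕ => sieveWeight β (p ^ n)) 1).1 h1
  rwa [Finset.sum_range_one, pow_zero, sieveWeight_one, add_comm] at h2

lemma sum_sieveWeight_le_prod {β : ℝ} (hβ : 0 ≤ β) (M : ℕ) :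
    ∑ m ∈ Finset.Icc 1 M, sieveWeight β m ≤
      ∏ p ∈ Nat.primesBelow (M + 1), (1 + β * (1 + 8 / (p : ℝ)) / (p - 1)) := by
  have h := (EulerProduct.summable_and_hasSum_smoothNumbers_prod_primesBelow_tsum
    (f := sieveWeight β) (sieveWeight_one β) (fun h => sieveWeight_mul β h)
    (fun hp => (hasSum_sieveWeight_pow β hp).summable.norm) (M + 1)).2
  have hprod : ∏ p ∈ Nat.primesBelow (M + 1), ∑' n : ℕ, sieveWeight β (p ^ n) =
      ∏ p ∈ Nat.primesBelow (M + 1), (1 + β * (1 + 8 / (p : ℝ)) / (p - 1)) :=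
    Finset.prod_congr rfl fun p hp =>
      (hasSum_sieveWeight_pow β (Nat.mem_primesBelow.1 hp).2).tsum_eq
  rw [hprod] at h
  have h' := (hasSum_subtype_iff_indicator (f := sieveWeight β)).1 h
  calc ∑ m ∈ Finset.Icc 1 M, sieveWeight β m =
        ∑ m ∈ Finset.Icc 1 M, (Nat.smoothNumbers (M + 1)).indicator (sieveWeight β) m := by
        refine Finset.sum_congr rfl fun m hm => ?_
        rw [Finset.mem_Icc] at hm
        rw [Set.indicator_of_mem (Nat.mem_smoothNumbers_of_lt hm.1 (Nat.lt_succ_of_le hm.2))]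
    _ ≤ _ := sum_le_hasSum _ (fun m _ => Set.indicator_nonneg (fun m _ => sieveWeight_nonneg hβ m) m) h'

lemma exists_sum_sieveWeight_le {β : ℝ} (hβ : 0 ≤ β) (hβ1 : β ≤ 1) :
    ∃ C : ℝ, 0 ≤ C ∧ ∀ᶠ t : ℝ in Filter.atTop,
      ∑ m ∈ Finset.Icc 1 ⌊Real.exp (Real.exp t)⌋₊, sieveWeight β m ≤
        C * t * Real.exp (β * t) := by
  obtain ⟨C₂, hC₂, h2⟩ := sum_primes_inv_le
  have hz := Real.tendsto_exp_atTop.comp Real.tendsto_exp_atTop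
  set B : ℝ := ∑' n : ℕ, 18 / (n : ℝ) ^ 2 with hB
  have hsum : Summable fun n : ℕ => 18 / (n : ℝ) ^ 2 :=
    ((Real.summable_one_div_nat_pow.2 one_lt_two).mul_left 18).congr fun n => by
      rw [mul_one_div]
  refine ⟨Real.exp (C₂ + B), (Real.exp_pos _).le, ?_⟩
  filter_upwards [hz.eventually h2, Filter.eventually_ge_atTop 1] with t ht2 ht
  simp only [Function.comp_apply, Real.log_exp] at ht2
  refine (sum_sieveWeight_le_prod hβ _).trans ?_
  set P := Nat.primesBelow (⌊Real.exp (Real.exp t)⌋₊ + 1)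
  have hterm : ∀ p ∈ P, 1 + β * (1 + 8 / (p : ℝ)) / (p - 1) ≤
      Real.exp (β * (1 / p) + 18 / (p : ℝ) ^ 2) := fun p hp => by
    have hp2 : (2 : ℝ) ≤ p := by exact_mod_cast (Nat.mem_primesBelow.1 hp).2.two_le
    have hpm : 0 < (p : ℝ) - 1 := by linarith
    have hp0 : 0 < (p : ℝ) := by linarith
    have h9 : 9 / ((p : ℝ) * (p - 1)) ≤ 18 / (p : ℝ) ^ 2 := by
      rw [div_le_div_iff₀ (by positivity) (by positivity)]
      nlinarith
    have h1 : β * (1 + 8 / (p : ℝ)) / (p - 1) = β * (1 / p) + β * (9 / ((p : ℝ) * (p - 1))) := by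
      field_simp; ring
    have h0 : 0 ≤ 9 / ((p : ℝ) * (p - 1)) := by positivity
    have h3 : β * (9 / ((p : ℝ) * (p - 1))) ≤ 9 / ((p : ℝ) * (p - 1)) :=
      mul_le_of_le_one_left h0 hβ1
    have := Real.add_one_le_exp (β * (1 / p) + 18 / (p : ℝ) ^ 2)
    linarith
  have hnn : ∀ p ∈ P, 0 ≤ 1 + β * (1 + 8 / (p : ℝ)) / (p - 1) := fun p hp => by
    have hp2 : (2 : ℝ) ≤ p := by exact_mod_cast (Nat.mem_primesBelow.1 hp).2.two_le
    have hpm : 0 < (p : ℝ) - 1 := by linarith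
    positivity
  calc _ ≤ ∏ p ∈ P, Real.exp (β * (1 / p) + 18 / (p : ℝ) ^ 2) := Finset.prod_le_prod hnn hterm
    _ = Real.exp (β * ∑ p ∈ P, 1 / (p : ℝ) + ∑ p ∈ P, 18 / (p : ℝ) ^ 2) := by
      rw [← Real.exp_sum, Finset.sum_add_distrib, Finset.mul_sum]
    _ ≤ Real.exp (C₂ + B + Real.log t + β * t) := by
      apply Real.exp_le_exp.2
      have h5 : ∑ p ∈ P, 18 / (p : ℝ) ^ 2 ≤ B := hsum.sum_le_tsum _ fun n _ => by positivity
      have h6 := mul_le_mul_of_nonneg_left ht2 hβ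
      have h7 : β * (Real.log t + C₂) ≤ Real.log t + C₂ :=
        mul_le_of_le_one_left (add_nonneg (Real.log_nonneg ht) hC₂) hβ1
      linarith
    _ = _ := by
      rw [Real.exp_add, Real.exp_add, Real.exp_log (by linarith)]

/-- The integers counted by the theorem. -/
def sumSqProducts (α N : ℝ) : Set ℕ :=
  {n : ℕ | 1 < n ∧ (n : ℝ) ≤ N ∧
    (n.primeFactors.card : ℝ) ≤ α * Real.log (Real.log N) ∧
    N ^ (1 / Real.log (Real.log N)) < (maxPrimeFac n : ℝ) ∧
    ∃ a b : ℕ, 0 < a ∧ 0 < b ∧ n = a * b ∧ Nat.Prime (a ^ 2 + b ^ 2)}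

lemma prime_maxPrimeFac {n : ℕ} (hn : 1 < n) : (maxPrimeFac n).Prime ∧ maxPrimeFac n ∣ n := by
  rw [maxPrimeFac, if_neg hn.not_ge]
  obtain ⟨p, hp, hpn⟩ := Finset.exists_mem_eq_sup n.primeFactors
    (Nat.nonempty_primeFactors.2 hn) id
  rw [hpn]
  exact ⟨Nat.prime_of_mem_primeFactors hp, Nat.dvd_of_mem_primeFactors hp⟩

lemma coprime_of_prime_sq_add_sq {p c b : ℕ} (h : ((p * c) ^ 2 + b ^ 2).Prime) : c.Coprime b := by
  refine Nat.Coprime.symm (Nat.coprime_of_dvd fun k hk hkb hkc => ?_)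
  have h1 : k * k ∣ (p * c) ^ 2 + b ^ 2 := by
    rw [← sq]
    exact dvd_add (pow_dvd_pow_of_dvd (hkc.mul_left p) 2) (pow_dvd_pow_of_dvd hkb 2)
  exact hk.ne_one (Nat.isUnit_iff.1 (h.prime.squarefree k h1))

lemma exists_of_mem_sumSqProducts {α N : ℝ} {n : ℕ} (hn : n ∈ sumSqProducts α N) :
    ∃ c b p : ℕ, 0 < c ∧ 0 < b ∧ n = p * (c * b) ∧ p.Prime ∧
      N ^ (1 / Real.log (Real.log N)) < (p : ℝ) ∧ ((p * c) ^ 2 + b ^ 2).Prime := by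
  obtain ⟨h1, -, -, hP, a, b, ha, hb, rfl, hab⟩ := hn
  obtain ⟨hp, hpn⟩ := prime_maxPrimeFac h1
  generalize maxPrimeFac (a * b) = p at hp hpn hP
  rcases hp.dvd_mul.1 hpn with ⟨c, rfl⟩ | ⟨c, rfl⟩
  · exact ⟨c, b, p, Nat.pos_of_mul_pos_left ha, hb, by ring, hp, hP, hab⟩
  · exact ⟨c, a, p, Nat.pos_of_mul_pos_left hb, ha, by ring, hp, hP, by rwa [add_comm]⟩

lemma sumSqProducts_subset {α N : ℝ} :
    sumSqProducts α N ⊆ (Finset.Icc 1 ⌊N⌋₊ : Finset ℕ) := fun n hn => by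
  rw [Finset.mem_coe, Finset.mem_Icc]
  exact ⟨hn.1.le, Nat.le_floor hn.2.1⟩

lemma ncard_sumSqProducts_le_sum (α N : ℝ) :
    ((sumSqProducts α N).ncard : ℝ) ≤
      ∑ x ∈ (Finset.Icc 1 ⌊N⌋₊ ×ˢ Finset.Icc 1 ⌊N⌋₊).filter (fun x : ℕ × ℕ =>
          x.1.Coprime x.2 ∧ ((x.1 * x.2).primeFactors.card : ℝ) ≤ α * Real.log (Real.log N) ∧
          N ^ (1 / Real.log (Real.log N)) ≤ N / ((x.1 * x.2 : ℕ) : ℝ)),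
        ((sumSqPrimes x.1 x.2 (N ^ (1 / Real.log (Real.log N))) (N / ((x.1 * x.2 : ℕ) : ℝ))).card
          : ℝ) := by
  classical
  set Y := N ^ (1 / Real.log (Real.log N))
  set I := (Finset.Icc 1 ⌊N⌋₊ ×ˢ Finset.Icc 1 ⌊N⌋₊).filter (fun x : ℕ × ℕ =>
    x.1.Coprime x.2 ∧ ((x.1 * x.2).primeFactors.card : ℝ) ≤ α * Real.log (Real.log N) ∧
    Y ≤ N / ((x.1 * x.2 : ℕ) : ℝ)) with hI
  have hsub : sumSqProducts α N ⊆ (I.biUnion fun x =>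
      (sumSqPrimes x.1 x.2 Y (N / ((x.1 * x.2 : ℕ) : ℝ))).image fun p => p * (x.1 * x.2) :
      Finset ℕ) := by
    intro n hn
    obtain ⟨c, b, p, hc, hb, rfl, hp, hpY, hpr⟩ := exists_of_mem_sumSqProducts hn
    obtain ⟨-, hnN, hω, -, -⟩ := hn
    have hcb : 0 < c * b := Nat.mul_pos hc hb
    have hpX : (p : ℝ) ≤ N / ((c * b : ℕ) : ℝ) := by
      rw [le_div_iff₀ (by exact_mod_cast hcb)]
      exact_mod_cast hnN
    have hle : ∀ d : ℕ, d ∣ p * (c * b) → d ≤ ⌊N⌋₊ := fun d hd =>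
      (Nat.le_of_dvd (Nat.mul_pos hp.pos hcb) hd).trans (Nat.le_floor hnN)
    rw [Finset.mem_coe, Finset.mem_biUnion]
    refine ⟨(c, b), ?_, Finset.mem_image.2 ⟨p, ?_, rfl⟩⟩
    · rw [hI, Finset.mem_filter, Finset.mem_product, Finset.mem_Icc, Finset.mem_Icc]
      refine ⟨⟨⟨hc, hle c ⟨p * b, by ring⟩⟩, hb, hle b ⟨p * c, by ring⟩⟩,
        coprime_of_prime_sq_add_sq hpr, le_trans ?_ hω, hpY.le.trans hpX⟩
      exact Nat.cast_le.2 (Finset.card_le_card (Nat.primeFactors_mono (dvd_mul_left _ _)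
        (Nat.mul_pos hp.pos hcb).ne'))
    · exact Finset.mem_filter.2 ⟨Finset.mem_range_succ_iff.2 (Nat.le_floor hpX), hp, hpY, hpr⟩
  have h1 := Set.ncard_le_ncard hsub (Finset.finite_toSet _)
  rw [Set.ncard_coe_finset] at h1
  have h2 := h1.trans (Finset.card_biUnion_le.trans
    (Finset.sum_le_sum fun x _ => Finset.card_image_le))
  exact_mod_cast h2

lemma sieveFactor_div_le {β s : ℝ} (hβ : 0 < β) (hβ1 : β ≤ 1) {c b : ℕ} (h : c.Coprime b)
    (hω : ((c * b).primeFactors.card : ℝ) ≤ s) :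
    sieveFactor (c * b) / ((c * b : ℕ) : ℝ) ≤
      Real.exp (-(s * Real.log β)) * (sieveWeight β c * sieveWeight β b) := by
  rw [← sieveWeight_mul β h, sieveWeight_eq, mul_div_assoc, ← mul_assoc]
  refine le_mul_of_one_le_left (div_nonneg (zero_le_one.trans (one_le_sieveFactor _))
    (Nat.cast_nonneg _)) ?_
  rw [← Real.exp_log (pow_pos hβ _), ← Real.exp_add, Real.log_pow]
  apply Real.one_le_exp
  have := mul_le_mul_of_nonpos_right hω (Real.log_nonpos hβ.le hβ1)
  linarith

lemma exists_ncard_sumSqProducts_le {α : ℝ} (hα : 0 < α) (hα2 : α ≤ 2) :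
    ∃ C : ℝ, 0 ≤ C ∧ ∀ᶠ t : ℝ in Filter.atTop,
      ((sumSqProducts α (Real.exp (Real.exp t))).ncard : ℝ) ≤
        C * Real.exp (Real.exp t) * t ^ 8 *
          Real.exp (t * (α * (1 + Real.log 2 - Real.log α) - 2)) := by
  obtain ⟨C₁, hC₁, h1⟩ := exists_card_sumSqPrimes_le
  obtain ⟨C₂, hC₂, h2⟩ := exists_sum_sieveWeight_le (β := α / 2) (by positivity) (by linarith)
  have hβ : 0 < α / 2 := by positivity
  refine ⟨C₁ * C₂ ^ 2, by positivity, ?_⟩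
  filter_upwards [h1, h2, Filter.eventually_ge_atTop 1] with t ht1 ht2 ht
  have ht0 : 0 < t := by linarith
  set N := Real.exp (Real.exp t) with hN
  have hN0 : 0 < N := Real.exp_pos _
  have hLL : Real.log (Real.log N) = t := by rw [hN, Real.log_exp, Real.log_exp]
  have hY : N ^ (1 / Real.log (Real.log N)) = Real.exp (Real.exp t / t) := by
    rw [hLL, hN, ← Real.exp_mul, mul_one_div]
  refine (ncard_sumSqProducts_le_sum α N).trans ?_
  rw [hY, hLL]
  set D := C₁ * N * t ^ 6 * Real.exp (-2 * t) * Real.exp (-(α * t * Real.log (α / 2))) with hD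
  set w := sieveWeight (α / 2) with hw
  have hw0 : ∀ m, 0 ≤ w m := sieveWeight_nonneg hβ.le
  calc _ ≤ ∑ x ∈ (Finset.Icc 1 ⌊N⌋₊ ×ˢ Finset.Icc 1 ⌊N⌋₊).filter (fun x : ℕ × ℕ =>
          x.1.Coprime x.2 ∧ ((x.1 * x.2).primeFactors.card : ℝ) ≤ α * t ∧
          Real.exp (Real.exp t / t) ≤ N / ((x.1 * x.2 : ℕ) : ℝ)), D * (w x.1 * w x.2) := by
        refine Finset.sum_le_sum fun x hx => ?_
        obtain ⟨c, b⟩ := x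
        rw [Finset.mem_filter, Finset.mem_product, Finset.mem_Icc, Finset.mem_Icc] at hx
        obtain ⟨⟨⟨hc, -⟩, hb, -⟩, hcop, hω, hYX⟩ := hx
        refine (ht1 c b hc hb _ hYX).trans ?_
        have h3 := sieveFactor_div_le hβ (by linarith) hcop hω
        have h4 := mul_le_mul_of_nonneg_left h3
          (by positivity : 0 ≤ C₁ * N * t ^ 6 * Real.exp (-2 * t))
        calc _ = C₁ * N * t ^ 6 * Real.exp (-2 * t) *
              (sieveFactor (c * b) / ((c * b : ℕ) : ℝ)) := by ring
          _ ≤ _ := h4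
          _ = _ := by rw [hD]; ring
    _ ≤ ∑ x ∈ Finset.Icc 1 ⌊N⌋₊ ×ˢ Finset.Icc 1 ⌊N⌋₊, D * (w x.1 * w x.2) :=
        Finset.sum_le_sum_of_subset_of_nonneg (Finset.filter_subset _ _) fun x _ _ =>
          mul_nonneg (by positivity) (mul_nonneg (hw0 _) (hw0 _))
    _ = D * (∑ m ∈ Finset.Icc 1 ⌊N⌋₊, w m) ^ 2 := by
        rw [← Finset.mul_sum, sq, Finset.sum_mul_sum, Finset.sum_product]
    _ ≤ D * (C₂ * t * Real.exp (α / 2 * t)) ^ 2 := by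
        have : 0 ≤ ∑ m ∈ Finset.Icc 1 ⌊N⌋₊, w m := Finset.sum_nonneg fun m _ => hw0 m
        gcongr
    _ = _ := by
        have he : Real.exp (t * (α * (1 + Real.log 2 - Real.log α) - 2)) =
            Real.exp (-2 * t) * Real.exp (-(α * t * Real.log (α / 2))) *
              Real.exp (α / 2 * t) ^ 2 := by
          rw [← Real.exp_nat_mul, ← Real.exp_add, ← Real.exp_add,
            Real.log_div hα.ne' two_ne_zero]
          congr 1
          push_cast
          ring
        rw [he, hD]
        ring

lemma one_le_log_log {N : ℝ} (hN : 16 ≤ N) : 1 ≤ Real.log (Real.log N) := by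
  have h16 : Real.exp 1 ≤ Real.log 16 := by
    rw [show (16 : ℝ) = 2 ^ 4 by norm_num, Real.log_pow]
    push_cast
    linarith [Real.exp_one_lt_d9, Real.log_two_gt_d9]
  have h := h16.trans (Real.log_le_log (by norm_num) hN)
  exact (Real.le_log_iff_exp_le ((Real.exp_pos 1).trans_le h)).2 h

theorem stmt_10 (α : ℝ) (hα1 : 1 < α) (hα2 : α < 2) :
    ∃ C K : ℝ, 0 < C ∧ 0 ≤ K ∧ ∀ N : ℝ, 16 ≤ N →
      ({n : ℕ | 1 < n ∧ (n : ℝ) ≤ N ∧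
          (n.primeFactors.card : ℝ) ≤ α * Real.log (Real.log N) ∧
          N ^ (1 / Real.log (Real.log N)) < (maxPrimeFac n : ℝ) ∧
          ∃ a b : ℕ, 0 < a ∧ 0 < b ∧ n = a * b ∧ Nat.Prime (a ^ 2 + b ^ 2)}.ncard : ℝ)
        ≤ C * N * Real.log (Real.log N) ^ K *
            Real.log N ^ (α * (1 + Real.log 2 - Real.log α) - 2) := by
  obtain ⟨C, hC, h⟩ := exists_ncard_sumSqProducts_le (by linarith : 0 < α) hα2.le
  obtain ⟨T, hT⟩ := Filter.eventually_atTop.1 h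
  set e := α * (1 + Real.log 2 - Real.log α) - 2
  refine ⟨C + Real.exp (|T| * |e|), 8, by positivity, by norm_num, fun N hN => ?_⟩
  change ((sumSqProducts α N).ncard : ℝ) ≤ _
  have ht1 := one_le_log_log hN
  set t := Real.log (Real.log N) with ht
  have hN0 : 0 < N := by linarith
  have hlog : 0 < Real.log N := Real.log_pos (by linarith)
  have hLN : Real.log N = Real.exp t := (Real.exp_log hlog).symm
  have hNt : N = Real.exp (Real.exp t) := by rw [← hLN, Real.exp_log hN0]
  have hpow : Real.log N ^ e = Real.exp (t * e) := by rw [hLN, ← Real.exp_mul]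
  have ht8 : t ^ (8 : ℝ) = t ^ 8 := by norm_cast
  rw [hpow, ht8]
  rcases le_total T t with hTt | hTt
  · have h1 := hT t hTt
    rw [← hNt] at h1
    refine h1.trans ?_
    gcongr
    exact le_add_of_nonneg_right (Real.exp_pos _).le
  · have h1 : ((sumSqProducts α N).ncard : ℝ) ≤ N := by
      have h2 := Set.ncard_le_ncard (sumSqProducts_subset (α := α) (N := N))
        (Finset.finite_toSet _)
      rw [Set.ncard_coe_finset, Nat.card_Icc, Nat.add_sub_cancel] at h2
      exact (Nat.cast_le.2 h2).trans (Nat.floor_le hN0.le)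
    have h3 : 1 ≤ Real.exp (|T| * |e|) * Real.exp (t * e) := by
      rw [← Real.exp_add]
      apply Real.one_le_exp
      have h4 : |t * e| ≤ |T| * |e| := by
        rw [abs_mul]
        exact mul_le_mul_of_nonneg_right (abs_le_abs_of_nonneg (by linarith) hTt) (abs_nonneg e)
      linarith [neg_abs_le (t * e)]
    have h5 : 1 ≤ t ^ 8 := one_le_pow₀ ht1
    calc ((sumSqProducts α N).ncard : ℝ) ≤ N * (1 * 1) := by linarith
      _ ≤ N * ((Real.exp (|T| * |e|) * Real.exp (t * e)) * t ^ 8) := by gcongr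
      _ = Real.exp (|T| * |e|) * N * t ^ 8 * Real.exp (t * e) := by ring
      _ ≤ _ := by
        gcongr
        exact le_add_of_nonneg_left hC
end

section
/- There exist constants C > 0 and K ≥ 0 such that for all real N ≥ 16 and all pairwise coprime positive integers g, u, v, w with u ≠ v, the number of primes ℓ with N^{1/log log N} < ℓ ≤ N/(guvw) such that both (gu)² + (vw)²ℓ² and (gv)² + (uw)²ℓ² are prime is at most C · N · (log log N)^K / (g · u · v · w · (log N)³). -/
open Real

/-- Bonferroni's inequality, truncated after an even number of steps. -/
theorem indicator_empty_le_truncated_sum {α : Type*} [DecidableEq α] (T : Finset α) (r : ℕ) :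
    (if T = ∅ then (1 : ℝ) else 0) ≤
      ∑ S ∈ T.powerset, if S.card ≤ 2 * r then (-1 : ℝ) ^ S.card else 0 := by
  rw [Finset.sum_powerset_apply_card (fun m => if m ≤ 2 * r then (-1 : ℝ) ^ m else 0)]
  rcases T.eq_empty_or_nonempty with rfl | hT
  · simp
  rw [if_neg hT.ne_empty]
  obtain ⟨n, hn⟩ : ∃ n, T.card = n + 1 := ⟨T.card - 1, by have := hT.card_pos; omega⟩
  have key := Int.alternating_sum_range_choose_eq_choose (n := n) (m := 2 * r)
  have h2 : (∑ k ∈ Finset.range (2 * r + 1), ((-1) ^ k * ((n + 1).choose k : ℝ))) =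
      n.choose (2 * r) := by
    have := congrArg (fun x : ℤ => (x : ℝ)) key
    push_cast at this
    simpa using this
  have h3 : ∑ m ∈ Finset.range (T.card + 1),
      T.card.choose m • (if m ≤ 2 * r then (-1 : ℝ) ^ m else 0) = n.choose (2 * r) := by
    rw [← h2, hn]
    calc _ = ∑ m ∈ (Finset.range (n + 1 + 1)).filter (· ≤ 2 * r),
          ((-1 : ℝ) ^ m * ((n + 1).choose m : ℝ)) := by
          rw [Finset.sum_filter]
          refine Finset.sum_congr rfl fun m _ => ?_
          split_ifs <;> simp [mul_comm]
      _ = _ := by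
          refine Finset.sum_subset (fun m hm => ?_) (fun m hm hm' => ?_)
          · simp at hm ⊢; omega
          · have : n + 1 < m := by
              simp at hm hm'; omega
            simp [Nat.choose_eq_zero_of_lt this]
  rw [h3]; positivity

theorem count_mul_of_periodic (A : ℕ → Prop) [DecidablePred A] {d : ℕ}
    (hA : Function.Periodic A d) (q : ℕ) : Nat.count A (q * d) = q * Nat.count A d := by
  induction q with
  | zero => simp
  | succ q ih =>
    rw [add_mul, one_mul, Nat.count_add, ih, add_mul, one_mul]
    congr 1
    have : (fun k => A (q * d + k)) = A := by
      funext k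
      rw [add_comm]
      exact hA.nat_mul q k
    simp only [this]

theorem abs_count_sub_le_of_periodic (A : ℕ → Prop) [DecidablePred A] {d : ℕ} (hd : 0 < d)
    (hA : Function.Periodic A d) (M : ℕ) :
    |(Nat.count A M : ℝ) - M * (Nat.count A d / d)| ≤ Nat.count A d := by
  have hd' : (0 : ℝ) < d := by exact_mod_cast hd
  have h1 : Nat.count A (M / d * d) ≤ Nat.count A M :=
    Nat.count_monotone A (Nat.div_mul_le_self M d)
  have h2 : Nat.count A M ≤ Nat.count A ((M / d + 1) * d) :=
    Nat.count_monotone A (by have := Nat.lt_div_mul_add (a := M) hd; rw [add_mul]; omega)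
  rw [count_mul_of_periodic A hA] at h1 h2
  have h1' : ((M / d : ℕ) : ℝ) * Nat.count A d ≤ Nat.count A M := by exact_mod_cast h1
  have h2' : (Nat.count A M : ℝ) ≤ ((M / d : ℕ) + 1) * Nat.count A d := by exact_mod_cast h2
  have h3 : ((M / d : ℕ) : ℝ) ≤ M / d := Nat.cast_div_le
  have h4 : (M : ℝ) / d ≤ (M / d : ℕ) + 1 := by
    rw [div_le_iff₀ hd']
    have := Nat.lt_div_mul_add (a := M) hd
    have : M ≤ (M / d + 1) * d := by rw [add_mul]; omega
    exact_mod_cast this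
  have h5 : (M : ℝ) * (Nat.count A d / d) = M / d * Nat.count A d := by ring
  have h0 : (0 : ℝ) ≤ Nat.count A d := by positivity
  rw [h5, abs_le]
  constructor <;> nlinarith [mul_le_mul_of_nonneg_right h3 h0, mul_le_mul_of_nonneg_right h4 h0]

theorem count_and_of_coprime (A B : ℕ → Prop) [DecidablePred A] [DecidablePred B] {a b : ℕ}
    (ha : 0 < a) (hb : 0 < b) (hab : a.Coprime b)
    (hA : Function.Periodic A a) (hB : Function.Periodic B b) :
    Nat.count (fun n => A n ∧ B n) (a * b) = Nat.count A a * Nat.count B b := by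
  simp only [Nat.count_eq_card_filter_range]
  rw [← Finset.card_product]
  refine Finset.card_bij (fun n _ => (n % a, n % b)) ?_ ?_ ?_
  · intro n hn
    simp only [Finset.mem_filter, Finset.mem_range, Finset.mem_product] at hn ⊢
    refine ⟨⟨Nat.mod_lt _ ha, ?_⟩, Nat.mod_lt _ hb, ?_⟩
    · rw [hA.map_mod_nat]; exact hn.2.1
    · rw [hB.map_mod_nat]; exact hn.2.2
  · intro m hm n hn h
    simp only [Finset.mem_filter, Finset.mem_range, Prod.mk.injEq] at hm hn h
    have : m ≡ n [MOD a * b] := (Nat.modEq_and_modEq_iff_modEq_mul hab).1 h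
    exact Nat.ModEq.eq_of_lt_of_lt this hm.1 hn.1
  · rintro ⟨x, y⟩ hxy
    simp only [Finset.mem_filter, Finset.mem_range, Finset.mem_product] at hxy
    obtain ⟨⟨hx, hAx⟩, hy, hBy⟩ := hxy
    have hk := (Nat.chineseRemainder hab x y).2
    have hxk : (Nat.chineseRemainder hab x y : ℕ) % a = x := by
      rw [hk.1, Nat.mod_eq_of_lt hx]
    have hyk : (Nat.chineseRemainder hab x y : ℕ) % b = y := by
      rw [hk.2, Nat.mod_eq_of_lt hy]
    refine ⟨Nat.chineseRemainder hab x y, ?_, by simp [hxk, hyk]⟩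
    simp only [Finset.mem_filter, Finset.mem_range]
    refine ⟨Nat.chineseRemainder_lt_mul hab x y ha.ne' hb.ne', ?_, ?_⟩
    · rw [← hA.map_mod_nat, hxk]; exact hAx
    · rw [← hB.map_mod_nat, hyk]; exact hBy

theorem periodic_natCast_mem {p : ℕ} (Ω : Finset (ZMod p)) :
    Function.Periodic (fun n : ℕ => (n : ZMod p) ∈ Ω) p := by
  intro n; simp

theorem count_natCast_mem {p : ℕ} (hp : 0 < p) (Ω : Finset (ZMod p)) :
    Nat.count (fun n : ℕ => (n : ZMod p) ∈ Ω) p = Ω.card := by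
  have : NeZero p := ⟨hp.ne'⟩
  rw [Nat.count_eq_card_filter_range]
  refine Finset.card_bij (fun n _ => (n : ZMod p)) ?_ ?_ ?_
  · intro n hn; simpa using (Finset.mem_filter.1 hn).2
  · intro m hm n hn h
    simp only [Finset.mem_filter, Finset.mem_range] at hm hn
    rw [ZMod.natCast_eq_natCast_iff] at h
    exact Nat.ModEq.eq_of_lt_of_lt h hm.1 hn.1
  · intro x hx
    exact ⟨x.val, by simp [ZMod.val_lt, hx], by simp⟩

theorem periodic_forall_natCast_mem (Ω : (p : ℕ) → Finset (ZMod p)) (S : Finset ℕ) :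
    Function.Periodic (fun n : ℕ => ∀ p ∈ S, (n : ZMod p) ∈ Ω p) (∏ p ∈ S, p) := by
  intro n
  refine propext (forall₂_congr fun p hp => ?_)
  have : ((∏ p ∈ S, p : ℕ) : ZMod p) = 0 :=
    (ZMod.natCast_eq_zero_iff _ _).2 (Finset.dvd_prod_of_mem _ hp)
  rw [Nat.cast_add, this, add_zero]

theorem count_forall_natCast_mem (Ω : (p : ℕ) → Finset (ZMod p)) (S : Finset ℕ)
    (hS : ∀ p ∈ S, p.Prime) :
    Nat.count (fun n : ℕ => ∀ p ∈ S, (n : ZMod p) ∈ Ω p) (∏ p ∈ S, p) = ∏ p ∈ S, (Ω p).card := by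
  induction S using Finset.induction_on with
  | empty => simp [Nat.count_eq_card_filter_range]
  | insert p S hp ih =>
    rw [Finset.prod_insert hp, Finset.prod_insert hp,
      ← ih fun q hq => hS q (Finset.mem_insert_of_mem hq)]
    have hpp := hS p (Finset.mem_insert_self p S)
    rw [← count_natCast_mem hpp.pos (Ω p), ← count_and_of_coprime _ _ hpp.pos
      (Finset.prod_pos fun q hq => (hS q (Finset.mem_insert_of_mem hq)).pos) ?_
      (periodic_natCast_mem _) (periodic_forall_natCast_mem Ω S)]
    · simp only [Finset.forall_mem_insert]
    · refine Nat.Coprime.prod_right fun q hq => ?_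
      refine (Nat.coprime_primes hpp (hS q (Finset.mem_insert_of_mem hq))).2 ?_
      rintro rfl; exact hp hq

theorem sum_powerset_card_le_le (P : Finset ℕ) {κ : ℕ} {z : ℝ} (hz : 1 ≤ z) (hPz : (P.card : ℝ) ≤ z)
    (R : ℕ) : ∑ S ∈ P.powerset, (if S.card ≤ R then (κ : ℝ) ^ S.card else 0) ≤ exp κ * z ^ R := by
  have hz0 : 0 < z := by linarith
  calc ∑ S ∈ P.powerset, (if S.card ≤ R then (κ : ℝ) ^ S.card else 0)
      ≤ ∑ S ∈ P.powerset, z ^ R * ∏ _p ∈ S, (κ / z : ℝ) := by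
        refine Finset.sum_le_sum fun S _ => ?_
        rw [Finset.prod_const, div_pow]
        split_ifs with h
        · rw [mul_div_assoc', le_div_iff₀ (by positivity), mul_comm]
          gcongr
        · positivity
    _ = z ^ R * ∏ _p ∈ P, (1 + κ / z : ℝ) := by rw [← Finset.mul_sum, Finset.prod_one_add]
    _ ≤ z ^ R * exp (∑ _p ∈ P, (κ / z : ℝ)) := by
        gcongr; exact prod_one_add_le_exp_sum P fun _ => by positivity
    _ ≤ exp κ * z ^ R := by
        rw [mul_comm]
        gcongr
        rw [Finset.sum_const, nsmul_eq_mul, mul_div_assoc', div_le_iff₀ hz0, mul_comm]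
        gcongr

theorem truncated_product_le (P : Finset ℕ) (x : ℕ → ℝ) (hx0 : ∀ p, 0 ≤ x p)
    (hx1 : ∀ p ∈ P, x p ≤ 1) (R : ℕ) :
    ∑ S ∈ P.powerset, (if S.card ≤ R then (-1 : ℝ) ^ S.card else 0) * ∏ p ∈ S, x p ≤
      exp (-∑ p ∈ P, x p) + exp (exp 1 * ∑ p ∈ P, x p - R) := by
  have h1 : ∑ S ∈ P.powerset, (-1 : ℝ) ^ S.card * ∏ p ∈ S, x p = ∏ p ∈ P, (1 + -x p) := by
    rw [Finset.prod_one_add]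
    exact Finset.sum_congr rfl fun S _ => (Finset.prod_neg _).symm
  have h2 : ∏ p ∈ P, (1 + -x p) ≤ exp (-∑ p ∈ P, x p) := by
    rw [← Finset.sum_neg_distrib, exp_sum]
    refine Finset.prod_le_prod (fun p hp => by linarith [hx1 p hp]) fun p _ => ?_
    rw [add_comm]; exact add_one_le_exp _
  have h3 : ∑ S ∈ P.powerset, exp (-R) * ∏ p ∈ S, (exp 1 * x p) ≤
      exp (exp 1 * ∑ p ∈ P, x p - R) := by
    rw [← Finset.mul_sum, ← Finset.prod_one_add, sub_eq_add_neg, add_comm, exp_add, Finset.mul_sum]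
    gcongr
    exact prod_one_add_le_exp_sum P fun p => mul_nonneg (exp_pos _).le (hx0 p)
  have h4 : ∑ S ∈ P.powerset, (if S.card ≤ R then (-1 : ℝ) ^ S.card else 0) * ∏ p ∈ S, x p ≤
      ∑ S ∈ P.powerset, ((-1 : ℝ) ^ S.card * ∏ p ∈ S, x p +
        exp (-R) * ∏ p ∈ S, (exp 1 * x p)) := by
    refine Finset.sum_le_sum fun S _ => ?_
    have h0 : 0 ≤ ∏ p ∈ S, x p := Finset.prod_nonneg fun p _ => hx0 p
    rw [Finset.prod_mul_distrib, Finset.prod_const, ← exp_nat_mul, mul_one, ← mul_assoc, ← exp_add]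
    split_ifs with h
    · have : 0 ≤ exp (-R + S.card : ℝ) * ∏ p ∈ S, x p := by positivity
      linarith
    · have h5 : 1 ≤ exp (-R + S.card : ℝ) := by
        rw [one_le_exp_iff]
        have : (R : ℝ) ≤ S.card := by exact_mod_cast (not_le.1 h).le
        linarith
      have h6 : -1 ≤ (-1 : ℝ) ^ S.card := by
        rcases neg_one_pow_eq_or ℝ S.card with h | h <;> norm_num [h]
      nlinarith
  rw [Finset.sum_add_distrib, h1] at h4
  linarith

/-- Brun's pure sieve. -/
theorem brun_sieve (P : Finset ℕ) (hP : ∀ p ∈ P, p.Prime) (Ω : (p : ℕ) → Finset (ZMod p)) {κ : ℕ}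
    (hκ : ∀ p ∈ P, (Ω p).card ≤ κ) {z : ℝ} (hz : 1 ≤ z) (hPz : (P.card : ℝ) ≤ z) (M r : ℕ) :
    (((Finset.range M).filter fun n : ℕ => ∀ p ∈ P, (n : ZMod p) ∉ Ω p).card : ℝ) ≤
      M * (exp (-∑ p ∈ P, ((Ω p).card / p : ℝ)) +
        exp (exp 1 * ∑ p ∈ P, ((Ω p).card / p : ℝ) - (2 * r : ℕ))) + exp κ * z ^ (2 * r) := by
  classical
  set A : Finset ℕ → ℕ → Prop := fun S n => ∀ p ∈ S, (n : ZMod p) ∈ Ω p with hA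
  set c : Finset ℕ → ℝ := fun S => if S.card ≤ 2 * r then (-1 : ℝ) ^ S.card else 0 with hc
  have hcount : ∀ S ∈ P.powerset, c S * Nat.count (A S) M ≤
      M * (c S * ∏ p ∈ S, ((Ω p).card / p : ℝ)) +
        (if S.card ≤ 2 * r then (κ : ℝ) ^ S.card else 0) := by
    intro S hS
    have hSP := Finset.mem_powerset.1 hS
    have hSp : ∀ p ∈ S, p.Prime := fun p hp => hP p (hSP hp)
    have h1 := abs_count_sub_le_of_periodic (A S) (Finset.prod_pos fun p hp => (hSp p hp).pos)
      (periodic_forall_natCast_mem Ω S) M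
    have h2 : ((Nat.count (A S) (∏ p ∈ S, p) : ℕ) : ℝ) = ∏ p ∈ S, ((Ω p).card : ℝ) := by
      rw [← Nat.cast_prod]; exact congrArg _ (count_forall_natCast_mem Ω S hSp)
    rw [h2] at h1
    push_cast at h1
    rw [← Finset.prod_div_distrib] at h1
    have h3 : ∏ p ∈ S, ((Ω p).card : ℝ) ≤ (κ : ℝ) ^ S.card := by
      rw [← Finset.prod_const]
      exact Finset.prod_le_prod (fun _ _ => by positivity)
        fun p hp => by exact_mod_cast hκ p (hSP hp)
    rw [abs_le] at h1
    simp only [hc]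
    split_ifs with h
    · rcases neg_one_pow_eq_or ℝ S.card with h | h <;> rw [h] <;> linarith
    · simp
  have hpt : ∀ n : ℕ, (if ∀ p ∈ P, (n : ZMod p) ∉ Ω p then (1 : ℝ) else 0) ≤
      ∑ S ∈ P.powerset, c S * if A S n then 1 else 0 := by
    intro n
    have h := indicator_empty_le_truncated_sum (P.filter fun p => (n : ZMod p) ∈ Ω p) r
    simp only [Finset.filter_eq_empty_iff] at h
    refine h.trans (le_of_eq ?_)
    simp only [mul_ite, mul_one, mul_zero]
    rw [← Finset.sum_filter (fun S => A S n)]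
    refine Finset.sum_congr ?_ fun _ _ => rfl
    ext S
    simp only [Finset.mem_powerset, Finset.mem_filter, Finset.subset_iff, hA]
    constructor
    · intro h; exact ⟨fun p hp => (h hp).1, fun p hp => (h hp).2⟩
    · intro h p hp; exact ⟨h.1 hp, h.2 p hp⟩
  have hmain : (((Finset.range M).filter fun n : ℕ => ∀ p ∈ P, (n : ZMod p) ∉ Ω p).card : ℝ) ≤
      ∑ S ∈ P.powerset, c S * Nat.count (A S) M := by
    rw [Finset.card_filter, Nat.cast_sum]
    push_cast
    refine (Finset.sum_le_sum fun n _ => hpt n).trans (le_of_eq ?_)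
    rw [Finset.sum_comm]
    refine Finset.sum_congr rfl fun S _ => ?_
    rw [← Finset.mul_sum, Nat.count_eq_card_filter_range, Finset.card_filter]
    push_cast; rfl
  refine hmain.trans ((Finset.sum_le_sum hcount).trans ?_)
  rw [Finset.sum_add_distrib, ← Finset.mul_sum]
  gcongr
  · refine truncated_product_le P (fun p => (Ω p).card / p) (fun p => by positivity) ?_ _
    intro p hp
    have hpp := hP p hp
    have : NeZero p := ⟨hpp.ne_zero⟩
    have : (Ω p).card ≤ p := by simpa using Finset.card_le_univ (Ω p)
    exact div_le_one_of_le₀ (by exact_mod_cast this) (by positivity)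
  · exact sum_powerset_card_le_le P hz hPz _

theorem inv_one_sub_le_exp {t : ℝ} (h2 : t ≤ 1 / 2) :
    (1 - t)⁻¹ ≤ exp (t + t ^ 2) := by
  have h0 : 0 < 1 - t := by linarith
  rw [inv_le_iff_one_le_mul₀ h0]
  rcases lt_or_ge t 0 with ht | ht
  · nlinarith [add_one_le_exp (t + t ^ 2), mul_nonneg (neg_nonneg.2 ht.le) (mul_self_nonneg t)]
  · have h4 := quadratic_le_exp_of_nonneg (x := t + t ^ 2) (by positivity)
    nlinarith [mul_nonneg ht ht, mul_nonneg (mul_nonneg ht ht) ht,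
      mul_nonneg (mul_nonneg ht ht) (mul_nonneg ht ht),
      mul_nonneg (mul_nonneg ht ht) (by linarith : 0 ≤ 1 / 2 - t)]

theorem sum_one_div_sq_le (s : Finset ℕ) :
    ∑ p ∈ s, (1 / (p : ℝ) ^ 2) ≤ ∑' n : ℕ, 1 / (n : ℝ) ^ 2 :=
  (Real.summable_one_div_nat_pow.2 one_lt_two).sum_le_tsum s fun _ _ => by positivity

theorem sum_le_of_hasSum_smoothNumbers {f : ℕ → ℝ} {Z : ℕ} {a : ℝ} (hf : ∀ n, 0 ≤ f n)
    (h : HasSum (fun m : Z.smoothNumbers => f m) a) : ∑ n ∈ Finset.Ioc 0 (Z - 1), f n ≤ a := by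
  have h := (hasSum_subtype_iff_indicator (f := f) (s := (Z.smoothNumbers : Set ℕ))).1 h
  calc ∑ n ∈ Finset.Ioc 0 (Z - 1), f n
      = ∑ n ∈ Finset.Ioc 0 (Z - 1), Set.indicator Z.smoothNumbers f n := by
        refine Finset.sum_congr rfl fun n hn => ?_
        rw [Finset.mem_Ioc] at hn
        rw [Set.indicator_of_mem (Nat.mem_smoothNumbers_of_lt hn.1 (by omega))]
    _ ≤ a := sum_le_hasSum _ (fun n _ => Set.indicator_nonneg (fun _ _ => hf _) _) h

theorem sum_Ioc_one_div_eq_harmonic (n : ℕ) :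
    ∑ m ∈ Finset.Ioc 0 n, (1 / (m : ℝ)) = (harmonic n : ℚ) := by
  rw [harmonic_eq_sum_Icc]
  push_cast
  refine Finset.sum_congr ?_ fun m _ => one_div _
  ext; simp; omega

theorem log_le_sum_Ioc_one_div {Z : ℕ} (hZ : 1 ≤ Z) :
    log Z ≤ ∑ m ∈ Finset.Ioc 0 (Z - 1), (1 / (m : ℝ)) := by
  rw [sum_Ioc_one_div_eq_harmonic]
  have := log_add_one_le_harmonic (Z - 1)
  rwa [Nat.sub_add_cancel hZ] at this

/-- `n ↦ n⁻¹` as a monoid homomorphism. -/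
noncomputable def invHom : ℕ →* ℝ where
  toFun n := 1 / (n : ℝ)
  map_one' := by simp
  map_mul' m n := by push_cast; rw [one_div_mul_one_div]

theorem log_le_exp_sum_primesBelow : ∃ C : ℝ, 0 < C ∧ ∀ Z : ℕ, 1 ≤ Z →
    log Z ≤ C * exp (∑ p ∈ Z.primesBelow, (1 / (p : ℝ))) := by
  refine ⟨exp (∑' n : ℕ, 1 / (n : ℝ) ^ 2), exp_pos _, fun Z hZ => ?_⟩
  have h := (EulerProduct.summable_and_hasSum_smoothNumbers_prod_primesBelow_geometric
    (f := invHom) (fun {p} hp => by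
      have : (1 : ℝ) < p := by exact_mod_cast hp.one_lt
      simp only [invHom, MonoidHom.coe_mk, OneHom.coe_mk, norm_div, norm_one, RCLike.norm_natCast]
      exact (div_lt_one (by linarith)).2 this) Z).2
  have h2 := sum_le_of_hasSum_smoothNumbers (fun n => by simp [invHom]) h
  refine (log_le_sum_Ioc_one_div hZ).trans (h2.trans ?_)
  rw [← exp_add]
  calc ∏ p ∈ Z.primesBelow, (1 - invHom p)⁻¹
      ≤ ∏ p ∈ Z.primesBelow, exp (1 / (p : ℝ) + 1 / (p : ℝ) ^ 2) := by
        refine Finset.prod_le_prod (fun p hp => ?_) fun p hp => ?_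
        all_goals
          have hp2 : (2 : ℝ) ≤ p := by exact_mod_cast (Nat.prime_of_mem_primesBelow hp).two_le
          have h3 : 1 / (p : ℝ) ≤ 1 / 2 := one_div_le_one_div_of_le (by norm_num) hp2
          have h4 : 0 ≤ 1 / (p : ℝ) := by positivity
        · have : invHom p = 1 / (p : ℝ) := rfl
          rw [this, inv_nonneg]; linarith
        · have := inv_one_sub_le_exp h3
          rwa [one_div_pow] at this
    _ = exp (∑ p ∈ Z.primesBelow, (1 / (p : ℝ)) + ∑ p ∈ Z.primesBelow, (1 / (p : ℝ) ^ 2)) := by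
        rw [← exp_sum, Finset.sum_add_distrib]
    _ ≤ _ := by
        rw [add_comm]; gcongr
        exact sum_one_div_sq_le _

/-- The arithmetic function `n ↦ χ₄(n) / n`. -/
noncomputable def chiDiv : ArithmeticFunction ℝ := ⟨fun n => (ZMod.χ₄ n : ℝ) / n, by simp⟩

/-- The arithmetic function `n ↦ 1 / n`. -/
noncomputable def oneDiv : ArithmeticFunction ℝ := ⟨fun n => 1 / n, by simp⟩

theorem chiDiv_apply (n : ℕ) : chiDiv n = (ZMod.χ₄ n : ℝ) / n := rfl

theorem oneDiv_apply (n : ℕ) : oneDiv n = 1 / (n : ℝ) := rfl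

theorem isMultiplicative_chiDiv : chiDiv.IsMultiplicative := by
  refine ⟨by simp [chiDiv_apply], fun {m n} _ => ?_⟩
  simp only [chiDiv_apply, Nat.cast_mul, map_mul, Int.cast_mul]
  rw [div_mul_div_comm]

theorem isMultiplicative_oneDiv : oneDiv.IsMultiplicative := by
  refine ⟨by simp [oneDiv_apply], fun {m n} _ => ?_⟩
  simp only [oneDiv_apply, Nat.cast_mul]
  rw [one_div_mul_one_div]

theorem chiDiv_mul_oneDiv_prime_pow {p : ℕ} (hp : p.Prime) (k : ℕ) :
    (chiDiv * oneDiv) (p ^ k) =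
      ∑ i ∈ Finset.range (k + 1), ((ZMod.χ₄ p : ℝ) / p) ^ i * (1 / (p : ℝ)) ^ (k - i) := by
  rw [ArithmeticFunction.mul_apply, Nat.sum_divisorsAntidiagonal fun a b => chiDiv a * oneDiv b,
    Nat.sum_divisors_prime_pow hp]
  refine Finset.sum_congr rfl fun i hi => ?_
  rw [Nat.pow_div (Finset.mem_range_succ_iff.1 hi) hp.pos]
  simp only [chiDiv_apply, oneDiv_apply, Nat.cast_pow, map_pow, Int.cast_pow, div_pow, one_pow]

theorem chi_mem (n : ℕ) : (ZMod.χ₄ n : ℝ) = 0 ∨ (ZMod.χ₄ n : ℝ) = 1 ∨ (ZMod.χ₄ n : ℝ) = -1 := by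
  rcases ZMod.isQuadratic_χ₄ n with h | h | h <;> simp [h]

theorem chiDiv_mul_oneDiv_nonneg (n : ℕ) : 0 ≤ (chiDiv * oneDiv) n := by
  rcases eq_or_ne n 0 with rfl | hn
  · simp
  rw [(isMultiplicative_chiDiv.mul isMultiplicative_oneDiv).multiplicative_factorization _ hn]
  refine Finset.prod_nonneg fun p hp => ?_
  have hpp : p.Prime := Nat.prime_of_mem_primeFactors (by simpa using hp)
  simp only [chiDiv_mul_oneDiv_prime_pow hpp]
  have key : ∑ i ∈ Finset.range (n.factorization p + 1),
      ((ZMod.χ₄ p : ℝ) / p) ^ i * (1 / (p : ℝ)) ^ (n.factorization p - i) =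
      (∑ i ∈ Finset.range (n.factorization p + 1), (ZMod.χ₄ p : ℝ) ^ i) *
        (1 / (p : ℝ)) ^ n.factorization p := by
    rw [Finset.sum_mul]
    refine Finset.sum_congr rfl fun i hi => ?_
    have : i ≤ n.factorization p := by simpa [Nat.lt_succ_iff] using hi
    rw [div_eq_mul_one_div, mul_pow, mul_assoc, ← pow_add, Nat.add_sub_cancel' this]
  rw [key]
  refine mul_nonneg ?_ (by positivity)
  rcases chi_mem p with h | h | h <;> rw [h]
  · exact Finset.sum_nonneg fun i _ => by positivity
  · exact Finset.sum_nonneg fun i _ => by positivity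
  · rw [neg_one_geom_sum]; split_ifs <;> norm_num

theorem sum_chi_mul_ge {G : ℕ → ℝ} (hG : ∀ a b, 0 < a → a ≤ b → G b ≤ G a) (K : ℕ) :
    G 1 - G 3 ≤ ∑ d ∈ Finset.range (4 * (K + 1)), (ZMod.χ₄ d : ℝ) * G d := by
  induction K with
  | zero =>
    simp only [zero_add, mul_one, Finset.sum_range_succ, Finset.sum_range_zero]
    have h0 : ZMod.χ₄ ((0 : ℕ) : ZMod 4) = 0 := by decide
    have h1 : ZMod.χ₄ ((1 : ℕ) : ZMod 4) = 1 := by decide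
    have h2 : ZMod.χ₄ ((2 : ℕ) : ZMod 4) = 0 := by decide
    have h3 : ZMod.χ₄ ((3 : ℕ) : ZMod 4) = -1 := by decide
    rw [h0, h1, h2, h3]; push_cast; linarith
  | succ K ih =>
    rw [show 4 * (K + 1 + 1) = 4 * (K + 1) + 1 + 1 + 1 + 1 by ring]
    simp only [Finset.sum_range_succ]
    have h0 : ZMod.χ₄ ((4 * (K + 1) : ℕ) : ZMod 4) = 0 := by
      rw [ZMod.χ₄_nat_eq_if_mod_four, if_pos (by omega)]
    have h1 : ZMod.χ₄ ((4 * (K + 1) + 1 : ℕ) : ZMod 4) = 1 := ZMod.χ₄_nat_one_mod_four (by omega)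
    have h2 : ZMod.χ₄ ((4 * (K + 1) + 1 + 1 : ℕ) : ZMod 4) = 0 := by
      rw [ZMod.χ₄_nat_eq_if_mod_four, if_pos (by omega)]
    have h3 : ZMod.χ₄ ((4 * (K + 1) + 1 + 1 + 1 : ℕ) : ZMod 4) = -1 :=
      ZMod.χ₄_nat_three_mod_four (by omega)
    rw [h0, h1, h2, h3]
    push_cast
    have := hG (4 * (K + 1) + 1) (4 * (K + 1) + 1 + 1 + 1) (by omega) (by omega)
    linarith

theorem log_le_sum_chiDiv_mul_oneDiv {Z : ℕ} (hZ : 1 ≤ Z) :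
    2 / 3 * log Z ≤ ∑ n ∈ Finset.Ioc 0 (Z - 1), (chiDiv * oneDiv) n := by
  set G : ℕ → ℝ := fun d => 1 / (d : ℝ) * ∑ m ∈ Finset.Ioc 0 ((Z - 1) / d), (1 / (m : ℝ)) with hGdef
  have hmono : ∀ {a b : ℕ}, a ≤ b →
      ∑ m ∈ Finset.Ioc 0 a, (1 / (m : ℝ)) ≤ ∑ m ∈ Finset.Ioc 0 b, (1 / (m : ℝ)) := fun {a b} h =>
    Finset.sum_le_sum_of_subset_of_nonneg (Finset.Ioc_subset_Ioc_right h) fun _ _ _ => by positivity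
  have hG : ∀ a b, 0 < a → a ≤ b → G b ≤ G a := by
    intro a b ha hab
    have ha' : (0 : ℝ) < a := by exact_mod_cast ha
    have hab' : (a : ℝ) ≤ b := by exact_mod_cast hab
    refine mul_le_mul (one_div_le_one_div_of_le ha' hab') (hmono (Nat.div_le_div_left hab ha))
      (Finset.sum_nonneg fun _ _ => by positivity) (by positivity)
  have h1 := sum_chi_mul_ge hG Z
  have h2 : ∑ n ∈ Finset.Ioc 0 (Z - 1), (chiDiv * oneDiv) n =
      ∑ d ∈ Finset.range (4 * (Z + 1)), (ZMod.χ₄ d : ℝ) * G d := by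
    rw [ArithmeticFunction.sum_Ioc_mul_eq_sum_sum]
    calc _ = ∑ d ∈ Finset.Ioc 0 (Z - 1), (ZMod.χ₄ d : ℝ) * G d := by
          refine Finset.sum_congr rfl fun d _ => ?_
          simp only [chiDiv_apply, oneDiv_apply, hGdef]
          ring
      _ = _ := by
          refine Finset.sum_subset (fun d hd => ?_) fun d _ hd => ?_
          · simp at hd ⊢; omega
          · have : d = 0 ∨ (Z - 1) / d = 0 := by
              rcases Nat.eq_zero_or_pos d with h | h
              · exact Or.inl h
              · right
                simp at hd
                exact Nat.div_eq_of_lt (by have := hd h; omega)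
            rcases this with rfl | h
            · simp
            · simp [hGdef, h]
  have h3 : G 3 ≤ 1 / 3 * G 1 := by
    simp only [hGdef]
    push_cast
    rw [div_one, one_mul, Nat.div_one]
    exact mul_le_mul_of_nonneg_left (hmono (Nat.div_le_self _ _)) (by norm_num)
  have h4 : log Z ≤ G 1 := by
    simpa [hGdef] using log_le_sum_Ioc_one_div hZ
  rw [h2]; linarith

theorem log_le_exp_sum_one_add_chi : ∃ C : ℝ, 0 < C ∧ ∀ Z : ℕ, 1 ≤ Z →
    log Z ≤ C * exp (∑ p ∈ Z.primesBelow, ((1 + ZMod.χ₄ p : ℝ) / p)) := by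
  refine ⟨3 / 2 * exp (2 * ∑' n : ℕ, 1 / (n : ℝ) ^ 2), by positivity, fun Z hZ => ?_⟩
  have hsmall : ∀ {p : ℕ}, p.Prime → 1 / (p : ℝ) ≤ 1 / 2 ∧ |(ZMod.χ₄ p : ℝ) / p| ≤ 1 / 2 := by
    intro p hp
    have hp2 : (2 : ℝ) ≤ p := by exact_mod_cast hp.two_le
    have h3 : 1 / (p : ℝ) ≤ 1 / 2 := one_div_le_one_div_of_le (by norm_num) hp2
    refine ⟨h3, ?_⟩
    have h4 : (0 : ℝ) ≤ 1 / p := by positivity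
    rcases chi_mem p with h | h | h <;> rw [h, abs_div, Nat.abs_cast] <;> simp <;> simp at h3 <;>
      linarith
  have hgeom : ∀ {p : ℕ}, p.Prime → Summable (fun n : ℕ => ‖((ZMod.χ₄ p : ℝ) / p) ^ n‖) ∧
      Summable (fun n : ℕ => ‖(1 / (p : ℝ)) ^ n‖) := by
    intro p hp
    obtain ⟨h1, h2⟩ := hsmall hp
    have h4 : (0 : ℝ) ≤ 1 / p := by positivity
    refine ⟨summable_norm_geometric_of_norm_lt_one ?_, summable_norm_geometric_of_norm_lt_one ?_⟩
    · rw [norm_eq_abs]; linarith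
    · rw [norm_eq_abs, abs_of_nonneg h4]; linarith
  have hlocal : ∀ {p : ℕ}, p.Prime → ∑' n : ℕ, (chiDiv * oneDiv) (p ^ n) =
      (1 - (ZMod.χ₄ p : ℝ) / p)⁻¹ * (1 - 1 / (p : ℝ))⁻¹ := by
    intro p hp
    obtain ⟨h1, h2⟩ := hsmall hp
    have h4 : (0 : ℝ) ≤ 1 / p := by positivity
    simp only [chiDiv_mul_oneDiv_prime_pow hp]
    rw [← tsum_mul_tsum_eq_tsum_sum_range_of_summable_norm (hgeom hp).1 (hgeom hp).2,
      tsum_geometric_of_norm_lt_one, tsum_geometric_of_norm_lt_one]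
    · rw [norm_eq_abs, abs_of_nonneg h4]; linarith
    · rw [norm_eq_abs]; linarith
  have hmul := isMultiplicative_chiDiv.mul isMultiplicative_oneDiv
  have h := (EulerProduct.summable_and_hasSum_smoothNumbers_prod_primesBelow_tsum
    (f := (chiDiv * oneDiv : ArithmeticFunction ℝ)) hmul.1 hmul.2 (fun {p} hp => by
      simp only [chiDiv_mul_oneDiv_prime_pow hp]
      exact summable_norm_sum_mul_range_of_summable_norm (hgeom hp).1 (hgeom hp).2) Z).2
  have h2 := (log_le_sum_chiDiv_mul_oneDiv hZ).trans
    (sum_le_of_hasSum_smoothNumbers chiDiv_mul_oneDiv_nonneg h)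
  have h5 : ∏ p ∈ Z.primesBelow, ∑' n : ℕ, (chiDiv * oneDiv) (p ^ n) ≤
      exp (2 * ∑' n : ℕ, 1 / (n : ℝ) ^ 2) *
        exp (∑ p ∈ Z.primesBelow, ((1 + ZMod.χ₄ p : ℝ) / p)) := by
    calc _ ≤ ∏ p ∈ Z.primesBelow, exp (2 * (1 / (p : ℝ) ^ 2) + (1 + ZMod.χ₄ p : ℝ) / p) := by
          refine Finset.prod_le_prod (fun p hp => ?_) fun p hp => ?_
          · exact tsum_nonneg fun _ => chiDiv_mul_oneDiv_nonneg _
          have hpp := Nat.prime_of_mem_primesBelow hp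
          rw [hlocal hpp]
          obtain ⟨h1, h2⟩ := hsmall hpp
          have h4 : (0 : ℝ) ≤ 1 / p := by positivity
          rw [abs_le] at h2
          have e1 := inv_one_sub_le_exp h2.2
          have e2 := inv_one_sub_le_exp h1
          refine (mul_le_mul e1 e2 (inv_nonneg.2 (by linarith)) (exp_pos _).le).trans ?_
          rw [← exp_add, exp_le_exp]
          have h6 : ((ZMod.χ₄ p : ℝ) / p) ^ 2 ≤ 1 / (p : ℝ) ^ 2 := by
            rw [div_pow]
            gcongr
            rcases chi_mem p with h | h | h <;> rw [h] <;> norm_num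
          rw [add_div, one_div_pow]; linarith
      _ = exp (2 * ∑ p ∈ Z.primesBelow, (1 / (p : ℝ) ^ 2) +
            ∑ p ∈ Z.primesBelow, ((1 + ZMod.χ₄ p : ℝ) / p)) := by
          rw [← exp_sum, Finset.sum_add_distrib, Finset.mul_sum]
      _ ≤ _ := by
          rw [exp_add]
          gcongr
          exact sum_one_div_sq_le _
  rw [mul_assoc]
  linarith

theorem sum_one_div_dyadic_le (s : Finset ℕ) {k : ℕ} (hk : 1 ≤ k)
    (hs : ∀ p ∈ s, p.Prime ∧ 2 ^ k ≤ p ∧ p < 2 ^ (k + 1)) :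
    ∑ p ∈ s, (1 / (p : ℝ)) ≤ 4 * (1 / (k : ℝ)) := by
  have hk' : (0 : ℝ) < k := by exact_mod_cast hk
  have hl2 : 0 < log 2 := log_pos one_lt_two
  have hθ : ∑ p ∈ s, log p ≤ log 4 * (2 : ℝ) ^ (k + 1) := by
    refine le_trans ?_ (Chebyshev.theta_le_log4_mul_x (x := (2 : ℝ) ^ (k + 1)) (by positivity))
    rw [Chebyshev.theta]
    refine Finset.sum_le_sum_of_subset_of_nonneg (fun p hp => ?_) fun p hp _ => ?_
    · obtain ⟨h1, _, h3⟩ := hs p hp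
      rw [Finset.mem_filter, Finset.mem_Ioc]
      refine ⟨⟨h1.pos, Nat.le_floor ?_⟩, h1⟩
      exact_mod_cast h3.le
    · exact log_nonneg (by exact_mod_cast (Finset.mem_filter.1 hp).2.one_le)
  have h1 : ∀ p ∈ s, 1 / (p : ℝ) * ((2 : ℝ) ^ k * (k * log 2)) ≤ log p := by
    intro p hp
    obtain ⟨hp1, hp2, _⟩ := hs p hp
    have hp2' : (2 : ℝ) ^ k ≤ p := by exact_mod_cast hp2
    have hp0 : (0 : ℝ) < p := by exact_mod_cast hp1.pos
    have h3 : k * log 2 ≤ log p := by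
      rw [← log_pow]; exact log_le_log (by positivity) hp2'
    calc 1 / (p : ℝ) * ((2 : ℝ) ^ k * (k * log 2)) ≤ 1 / (p : ℝ) * (p * log p) := by gcongr
      _ = log p := by field_simp
  have h2 := (Finset.sum_le_sum h1).trans hθ
  rw [← Finset.sum_mul, show (4 : ℝ) = 2 ^ 2 by norm_num, log_pow, pow_succ] at h2
  have h3 : (∑ p ∈ s, (1 / (p : ℝ)) * k) * (2 ^ k * log 2) ≤ 4 * (2 ^ k * log 2) := by
    rw [← Finset.sum_mul]; push_cast at h2; linarith
  have h4 := le_of_mul_le_mul_right h3 (by positivity)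
  rw [← Finset.sum_mul] at h4
  rw [mul_one_div, le_div_iff₀ hk']
  exact h4

theorem sum_one_div_prime_le {y : ℝ} (hy : exp 1 ≤ y) (s : Finset ℕ)
    (hs : ∀ p ∈ s, p.Prime ∧ (p : ℝ) ≤ y) :
    ∑ p ∈ s, (1 / (p : ℝ)) ≤ 4 * log (log y) + 8 := by
  have hy0 : 0 < y := (exp_pos 1).trans_le hy
  have hly : 1 ≤ log y := (le_log_iff_exp_le hy0).2 hy
  set m := Nat.log 2 ⌊y⌋₊ with hm
  have hmaps : ∀ p ∈ s, Nat.log 2 p ∈ Finset.Ioc 0 m := by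
    intro p hp
    obtain ⟨h1, h2⟩ := hs p hp
    exact Finset.mem_Ioc.2 ⟨Nat.log_pos one_lt_two h1.two_le, Nat.log_mono_right (Nat.le_floor h2)⟩
  rw [← Finset.sum_fiberwise_of_maps_to hmaps]
  have h1 : ∑ k ∈ Finset.Ioc 0 m, ∑ p ∈ s with Nat.log 2 p = k, (1 / (p : ℝ)) ≤
      ∑ k ∈ Finset.Ioc 0 m, 4 * (1 / (k : ℝ)) := by
    refine Finset.sum_le_sum fun k hk => ?_
    refine sum_one_div_dyadic_le _ (Finset.mem_Ioc.1 hk).1 fun p hp => ?_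
    obtain ⟨hp1, rfl⟩ := Finset.mem_filter.1 hp
    have h2 := (hs p hp1).1
    exact ⟨h2, Nat.pow_log_le_self 2 h2.ne_zero, Nat.lt_pow_succ_log_self one_lt_two p⟩
  rw [← Finset.mul_sum] at h1
  have h2 : ∑ k ∈ Finset.Ioc 0 m, (1 / (k : ℝ)) ≤ 1 + log m := by
    rw [sum_Ioc_one_div_eq_harmonic]
    exact harmonic_le_one_add_log m
  have hl2 : 0.5 < log 2 := by linarith [log_two_gt_d9]
  have hl2' : log 2 < 1 := by linarith [log_two_lt_d9]
  have h3 : log m ≤ 1 + log (log y) := by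
    rcases Nat.eq_zero_or_pos m with h | h
    · rw [h]; simp; linarith [log_nonneg hly]
    have h5 : (m : ℝ) * log 2 ≤ log y := by
      rw [← log_pow]
      refine log_le_log (by positivity) ?_
      have h6 : 2 ^ m ≤ ⌊y⌋₊ := Nat.pow_log_le_self 2 (by
        intro h0; rw [hm, h0] at h; simp at h)
      exact le_trans (by exact_mod_cast h6) (Nat.floor_le hy0.le)
    have h6 : (m : ℝ) ≤ 2 * log y := by
      have : (0 : ℝ) ≤ m := by positivity
      nlinarith
    have h7 : log m ≤ log (2 * log y) := log_le_log (by exact_mod_cast h) h6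
    rw [log_mul two_ne_zero (by linarith)] at h7
    linarith
  linarith

theorem card_primeFactors_mul_log_two_le {m : ℕ} (hm : m ≠ 0) :
    m.primeFactors.card * log 2 ≤ log m := by
  have h1 : 2 ^ m.primeFactors.card ≤ m :=
    (Finset.pow_card_le_prod _ _ _ fun p hp => (Nat.prime_of_mem_primeFactors hp).two_le).trans
      (Nat.le_of_dvd (Nat.pos_of_ne_zero hm) (Nat.prod_primeFactors_dvd m))
  rw [← log_pow]
  exact log_le_log (by positivity) (by exact_mod_cast h1)

theorem sum_one_div_primeFactors_le {m : ℕ} (hm : m ≠ 0) {L : ℝ} (hL : exp 1 ≤ L)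
    (hmL : log m ≤ 6 * L) :
    ∑ p ∈ m.primeFactors, (1 / (p : ℝ)) ≤ 4 * log (log L) + 20 := by
  have hL0 : 0 < L := (exp_pos 1).trans_le hL
  rw [← Finset.sum_filter_add_sum_filter_not _ fun p : ℕ => (p : ℝ) ≤ L]
  have h1 := sum_one_div_prime_le hL (m.primeFactors.filter fun p : ℕ => (p : ℝ) ≤ L) fun p hp =>
    ⟨Nat.prime_of_mem_primeFactors (Finset.mem_filter.1 hp).1, (Finset.mem_filter.1 hp).2⟩
  have h2 : ∑ p ∈ m.primeFactors.filter fun p : ℕ => ¬ (p : ℝ) ≤ L, (1 / (p : ℝ)) ≤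
      m.primeFactors.card * (1 / L) := by
    refine (Finset.sum_le_card_nsmul _ _ (1 / L) fun p hp => ?_).trans ?_
    · exact one_div_le_one_div_of_le hL0 (not_le.1 (Finset.mem_filter.1 hp).2).le
    · rw [nsmul_eq_mul]
      gcongr
      exact Finset.filter_subset _ _
  have h3 : (m.primeFactors.card : ℝ) * (1 / L) ≤ 12 := by
    rw [mul_one_div, div_le_iff₀ hL0]
    have := card_primeFactors_mul_log_two_le hm
    have hl2 : 0.5 < log 2 := by linarith [log_two_gt_d9]
    have : (0 : ℝ) ≤ m.primeFactors.card := by positivity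
    nlinarith
  linarith

/-- Modulo a prime not dividing the discriminant, the sieve removes `3 + 2χ₄(p)` classes. -/
theorem exists_sifted_classes {g u v w p : ℕ} (hp : p.Prime) (h2 : p ≠ 2) (hg : ¬ p ∣ g)
    (hu : ¬ p ∣ u) (hv : ¬ p ∣ v) (hw : ¬ p ∣ w) (huv : ¬ (p : ℤ) ∣ (u : ℤ) ^ 4 - v ^ 4) :
    ∃ Ω : Finset (ZMod p), (Ω.card : ℝ) = 3 + 2 * (ZMod.χ₄ p : ℝ) ∧ ∀ x ∈ Ω, x = 0 ∨
      ((g : ZMod p) * u) ^ 2 + (v * w) ^ 2 * x ^ 2 = 0 ∨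
      ((g : ZMod p) * v) ^ 2 + (u * w) ^ 2 * x ^ 2 = 0 := by
  have : Fact p.Prime := ⟨hp⟩
  have hodd : p % 2 = 1 := hp.eq_two_or_odd.resolve_left h2
  rcases (by omega : p % 4 = 3 ∨ p % 4 = 1) with h4 | h4
  · exact ⟨{0}, by simp [ZMod.χ₄_nat_three_mod_four h4]; norm_num, by simp⟩
  obtain ⟨i, hi⟩ := ZMod.exists_sq_eq_neg_one_iff.2 (by omega : p % 4 ≠ 3)
  have hcast : ∀ {n : ℕ}, ¬ p ∣ n → (n : ZMod p) ≠ 0 := fun h h0 =>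
    h ((ZMod.natCast_eq_zero_iff _ _).1 h0)
  have hg' := hcast hg
  have hu' := hcast hu
  have hv' := hcast hv
  have hw' := hcast hw
  have h2' : (2 : ZMod p) ≠ 0 := by
    have := hcast (n := 2) fun h => h2 ((Nat.prime_dvd_prime_iff_eq hp Nat.prime_two).1 h)
    exact_mod_cast this
  have huv' : (u : ZMod p) ^ 4 - (v : ZMod p) ^ 4 ≠ 0 := by
    intro h0
    refine huv ((ZMod.intCast_zmod_eq_zero_iff_dvd _ _).1 ?_)
    push_cast; exact h0
  have hi0 : i ≠ 0 := by rintro rfl; simp at hi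
  set a : ZMod p := i * (g * u / (v * w)) with ha
  set b : ZMod p := i * (g * v / (u * w)) with hb
  have ha0 : a ≠ 0 := by rw [ha]; positivity
  have hb0 : b ≠ 0 := by rw [hb]; positivity
  have ha2 : a ^ 2 * (v * w) ^ 2 = -(g * u) ^ 2 := by
    rw [ha, mul_pow, sq i, ← hi]; field_simp
  have hb2 : b ^ 2 * (u * w) ^ 2 = -(g * v) ^ 2 := by
    rw [hb, mul_pow, sq i, ← hi]; field_simp
  have hab : a ^ 2 ≠ b ^ 2 := by
    intro h
    rw [ha, hb, mul_pow, mul_pow, mul_right_inj' (pow_ne_zero 2 hi0)] at h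
    field_simp at h
    exact huv' (by linear_combination h)
  have hneg : ∀ {x : ZMod p}, x ≠ 0 → x ≠ -x := by
    intro x hx h
    have : 2 * x = 0 := by linear_combination h
    exact (mul_ne_zero h2' hx) this
  have hab1 : a ≠ b := fun h => hab (by rw [h])
  have hab2 : a ≠ -b := fun h => hab (by rw [h, neg_sq])
  have hab3 : -a ≠ b := fun h => hab (by rw [← h, neg_sq])
  refine ⟨{0, a, -a, b, -b}, ?_, ?_⟩
  · rw [ZMod.χ₄_nat_one_mod_four h4]
    rw [Finset.card_insert_of_notMem, Finset.card_insert_of_notMem, Finset.card_insert_of_notMem,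
      Finset.card_insert_of_notMem, Finset.card_singleton]
    · norm_num
    · simpa using hneg hb0
    · simp [hab3, hab1]
    · simp [hneg ha0, hab1, hab2]
    · simp [ha0.symm, hb0.symm, ha0, hb0]
  · intro x hx
    simp only [Finset.mem_insert, Finset.mem_singleton] at hx
    rcases hx with rfl | rfl | rfl | rfl | rfl
    · exact Or.inl rfl
    · exact Or.inr (Or.inl (by linear_combination ha2))
    · exact Or.inr (Or.inl (by linear_combination ha2))
    · exact Or.inr (Or.inr (by linear_combination hb2))
    · exact Or.inr (Or.inr (by linear_combination hb2))

theorem exp_neg_half_div_le {x : ℝ} (hx : 1 ≤ x) :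
    exp (-(exp x / (2 * x))) ≤ exp 27 / exp x ^ 3 := by
  rw [← exp_nat_mul, ← exp_sub, exp_le_exp]
  have h1 : x ^ 3 / 6 ≤ exp x := by
    have := pow_div_factorial_le_exp x (by linarith) 3
    simpa [Nat.factorial] using this
  have h2 : (3 * x - 27) * (2 * x) ≤ exp x := by
    nlinarith [mul_nonneg (by linarith : 0 ≤ x) (sq_nonneg (x - 18))]
  have h3 : 3 * x - 27 ≤ exp x / (2 * x) := by rwa [le_div_iff₀ (by linarith)]
  push_cast; linarith

/-- Lower bound for the sum of the sieve densities over primes not dividing `m`. -/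
theorem exp_neg_sum_density_le : ∃ C : ℝ, 0 < C ∧ ∀ (Z m : ℕ) (L : ℝ), 2 ≤ Z → m ≠ 0 →
    exp 1 ≤ L → log m ≤ 6 * L →
    exp (-∑ p ∈ Z.primesBelow with ¬ p ∣ m, ((3 + 2 * ZMod.χ₄ p : ℝ) / p)) ≤
      C * log L ^ 20 / log Z ^ 3 := by
  obtain ⟨C₁, hC₁, h₁⟩ := log_le_exp_sum_primesBelow
  obtain ⟨C₂, hC₂, h₂⟩ := log_le_exp_sum_one_add_chi
  refine ⟨C₁ * C₂ ^ 2 * exp 100, by positivity, fun Z m L hZ hm hL hmL => ?_⟩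
  have hlZ : 0 < log Z := log_pos (by exact_mod_cast hZ)
  have hL0 : 0 < L := (exp_pos 1).trans_le hL
  have hlL : 1 ≤ log L := (le_log_iff_exp_le hL0).2 hL
  set A := ∑ p ∈ Z.primesBelow, (1 / (p : ℝ))
  set B := ∑ p ∈ Z.primesBelow, ((1 + ZMod.χ₄ p : ℝ) / p)
  set D := ∑ p ∈ Z.primesBelow with ¬ p ∣ m, ((3 + 2 * ZMod.χ₄ p : ℝ) / p)
  have hsum : A + 2 * B = ∑ p ∈ Z.primesBelow, ((3 + 2 * ZMod.χ₄ p : ℝ) / p) := by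
    simp only [A, B]
    rw [Finset.mul_sum, ← Finset.sum_add_distrib]
    exact Finset.sum_congr rfl fun p _ => by ring
  have hbad : ∑ p ∈ Z.primesBelow with p ∣ m, ((3 + 2 * ZMod.χ₄ p : ℝ) / p) ≤
      5 * ∑ p ∈ m.primeFactors, (1 / (p : ℝ)) := by
    rw [Finset.mul_sum]
    refine (Finset.sum_le_sum fun p _ => ?_).trans
      (Finset.sum_le_sum_of_subset_of_nonneg (f := fun p : ℕ => 5 * (1 / (p : ℝ))) ?_
        fun _ _ _ => by positivity)
    · rw [mul_one_div]
      gcongr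
      rcases chi_mem p with h | h | h <;> rw [h] <;> norm_num
    · intro p hp
      obtain ⟨h3, h4⟩ := Finset.mem_filter.1 hp
      exact Nat.mem_primeFactors.2 ⟨Nat.prime_of_mem_primesBelow h3, h4, hm⟩
  have hD : A + 2 * B ≤ D + (20 * log (log L) + 100) := by
    rw [hsum, ← Finset.sum_filter_add_sum_filter_not _ fun p => p ∣ m]
    have := sum_one_div_primeFactors_le hm hL hmL
    linarith
  have h3 : log Z ^ 3 ≤ C₁ * C₂ ^ 2 * exp (A + 2 * B) := by
    have e : C₁ * C₂ ^ 2 * exp (A + 2 * B) = (C₁ * exp A) * (C₂ * exp B) ^ 2 := by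
      rw [exp_add, two_mul, exp_add]; ring
    rw [e, pow_succ' _ 2]
    gcongr
    · exact h₁ Z (by omega)
    · exact h₂ Z (by omega)
  have h4 : exp (A + 2 * B) ≤ exp D * (log L ^ 20 * exp 100) := by
    have e : log L ^ 20 = exp (20 * log (log L)) := by
      rw [← exp_log (by positivity : 0 < log L ^ 20), log_pow]; norm_num
    rw [e, ← exp_add, ← exp_add]
    exact exp_le_exp.2 hD
  rw [exp_neg, inv_le_iff_one_le_mul₀ (exp_pos D), div_mul_eq_mul_div, one_le_div (by positivity)]
  calc _ ≤ C₁ * C₂ ^ 2 * exp (A + 2 * B) := h3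
    _ ≤ C₁ * C₂ ^ 2 * (exp D * (log L ^ 20 * exp 100)) := by gcongr
    _ = _ := by ring

/-- `N ^ (1 / log log N)` in exponential form. -/
theorem rpow_one_div_log_log {N : ℝ} (hN : 0 < N) :
    N ^ (1 / log (log N)) = exp (log N / log (log N)) := by
  rw [rpow_def_of_pos hN, mul_one_div]

theorem not_mem_sifted_classes {g u v w p ℓ : ℕ} (hu : 0 < u) (hv : 0 < v)
    (hw : 0 < w) (hp : p.Prime) (hpl : p < ℓ) (hl : ℓ.Prime)
    (h1 : Nat.Prime ((g * u) ^ 2 + (v * w) ^ 2 * ℓ ^ 2))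
    (h2 : Nat.Prime ((g * v) ^ 2 + (u * w) ^ 2 * ℓ ^ 2)) {Ω : Finset (ZMod p)}
    (hΩ : ∀ x ∈ Ω, x = 0 ∨ ((g : ZMod p) * u) ^ 2 + (v * w) ^ 2 * x ^ 2 = 0 ∨
      ((g : ZMod p) * v) ^ 2 + (u * w) ^ 2 * x ^ 2 = 0) : (ℓ : ZMod p) ∉ Ω := by
  have hbig : ∀ a b : ℕ, 0 < b → ℓ ≤ a + b ^ 2 * ℓ ^ 2 := by
    intro a b hb
    have hb2 : 1 ≤ b ^ 2 := Nat.one_le_pow _ _ hb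
    nlinarith [hl.pos, Nat.le_self_pow two_ne_zero ℓ]
  have key : ∀ q : ℕ, q.Prime → ℓ ≤ q → (q : ZMod p) ≠ 0 := by
    intro q hq hlq h0
    have := (Nat.prime_dvd_prime_iff_eq hp hq).1 ((ZMod.natCast_eq_zero_iff _ _).1 h0)
    omega
  intro hmem
  rcases hΩ _ hmem with h | h | h
  · exact key ℓ hl le_rfl h
  · exact key _ h1 (hbig _ _ (Nat.mul_pos hv hw)) (by push_cast; exact h)
  · exact key _ h2 (hbig _ _ (Nat.mul_pos hu hw)) (by push_cast; exact h)

theorem discriminant_ne_zero {g u v w : ℕ} (hg : 0 < g) (hu : 0 < u) (hv : 0 < v) (hw : 0 < w)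
    (huv : u ≠ v) : 2 * (g * u * v * w) * ((u : ℤ) ^ 4 - v ^ 4).natAbs ≠ 0 := by
  have h : (u : ℤ) ^ 4 - v ^ 4 ≠ 0 := by
    rw [sub_ne_zero]
    intro h
    exact huv (Nat.pow_left_injective (n := 4) (by norm_num) (by exact_mod_cast h))
  have := Int.natAbs_pos.2 h
  positivity

theorem log_discriminant_le {g u v w : ℕ} (hg : 0 < g) (hu : 0 < u) (hv : 0 < v) (hw : 0 < w)
    (huv : u ≠ v) {N : ℝ} (hN : 16 ≤ N) (hT : (g * u * v * w : ℝ) ≤ N) :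
    log ((2 * (g * u * v * w) * ((u : ℤ) ^ 4 - v ^ 4).natAbs : ℕ) : ℝ) ≤ 6 * log N := by
  have hm := discriminant_ne_zero hg hu hv hw huv
  have hT' : ((g * u * v * w : ℕ) : ℝ) ≤ N := by push_cast; exact hT
  have huN : (u : ℝ) ≤ N := le_trans (by
    exact_mod_cast Nat.le_of_dvd (by positivity) ⟨g * v * w, by ring⟩) hT'
  have hvN : (v : ℝ) ≤ N := le_trans (by
    exact_mod_cast Nat.le_of_dvd (by positivity) ⟨g * u * w, by ring⟩) hT'
  have hD : ((((u : ℤ) ^ 4 - v ^ 4).natAbs : ℕ) : ℝ) ≤ N ^ 4 := by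
    rw [Nat.cast_natAbs]
    push_cast
    have h1 : (u : ℝ) ^ 4 ≤ N ^ 4 := by gcongr
    have h2 : (v : ℝ) ^ 4 ≤ N ^ 4 := by gcongr
    have h3 : (0 : ℝ) ≤ (u : ℝ) ^ 4 := by positivity
    have h4 : (0 : ℝ) ≤ (v : ℝ) ^ 4 := by positivity
    rw [abs_le]; constructor <;> linarith
  have h6 : (6 : ℝ) * log N = log (N ^ 6) := by rw [log_pow]; norm_num
  rw [h6]
  refine log_le_log (by exact_mod_cast Nat.pos_of_ne_zero hm) ?_
  rw [Nat.cast_mul, Nat.cast_mul]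
  calc ((2 : ℕ) : ℝ) * ((g * u * v * w : ℕ) : ℝ) * ((((u : ℤ) ^ 4 - v ^ 4).natAbs : ℕ) : ℝ)
      ≤ N * N * N ^ 4 := by
        gcongr
        push_cast; linarith
    _ = N ^ 6 := by ring

theorem exp_one_le_log {N : ℝ} (hN : 16 ≤ N) : exp 1 ≤ log N := by
  have h1 : log 16 ≤ log N := log_le_log (by norm_num) hN
  rw [show (16 : ℝ) = 2 ^ 4 by norm_num, log_pow] at h1
  push_cast at h1
  linarith [log_two_gt_d9, exp_one_lt_d9]

theorem sum_density_le {P : Finset ℕ} {N : ℝ} (hN : 16 ≤ N)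
    (hP : ∀ p ∈ P, p.Prime ∧ (p : ℝ) ≤ N) :
    exp 1 * ∑ p ∈ P, ((3 + 2 * ZMod.χ₄ p : ℝ) / p) ≤ 164 * log (log N) := by
  have hL := exp_one_le_log hN
  have hx : 1 ≤ log (log N) := (le_log_iff_exp_le ((exp_pos 1).trans_le hL)).2 hL
  have hNe : exp 1 ≤ N := by linarith [exp_one_lt_d9]
  have h1 : ∑ p ∈ P, ((3 + 2 * ZMod.χ₄ p : ℝ) / p) ≤ 5 * ∑ p ∈ P, (1 / (p : ℝ)) := by
    rw [Finset.mul_sum]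
    refine Finset.sum_le_sum fun p _ => ?_
    rw [mul_one_div]
    gcongr
    rcases chi_mem p with h | h | h <;> rw [h] <;> norm_num
  have h2 := sum_one_div_prime_le hNe P hP
  have h3 : exp 1 * ∑ p ∈ P, ((3 + 2 * ZMod.χ₄ p : ℝ) / p) ≤ exp 1 * (60 * log (log N)) := by
    gcongr; linarith
  nlinarith [exp_one_lt_d9]

theorem card_sifted_le : ∃ C : ℝ, 0 < C ∧ ∀ N : ℝ, 16 ≤ N →
    ∀ g u v w : ℕ, 0 < g → 0 < u → 0 < v → 0 < w → u ≠ v →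
      exp (log N / log (log N)) < N / (g * u * v * w) →
      ({ℓ : ℕ | ℓ.Prime ∧ exp (log N / log (log N)) < (ℓ : ℝ) ∧
          (ℓ : ℝ) ≤ N / (g * u * v * w) ∧
          Nat.Prime ((g * u) ^ 2 + (v * w) ^ 2 * ℓ ^ 2) ∧
          Nat.Prime ((g * v) ^ 2 + (u * w) ^ 2 * ℓ ^ 2)}.ncard : ℝ)
        ≤ C * (N / (g * u * v * w)) * (log (log N) ^ 26 / log N ^ 3) := by
  obtain ⟨C₀, hC₀, hdens⟩ := exp_neg_sum_density_le
  refine ⟨2 * (C₀ * 340 ^ 3 + 1) + exp 32, by positivity, ?_⟩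
  intro N hN g u v w hg hu hv hw huv hY
  have hL := exp_one_le_log hN
  set L := log N with hLdef
  have hL0 : 0 < L := (exp_pos 1).trans_le hL
  set x := log L with hxdef
  have hx : 1 ≤ x := (le_log_iff_exp_le hL0).2 hL
  have hx0 : 0 < x := by linarith
  have hLx : L = exp x := (exp_log hL0).symm
  set X : ℝ := N / (g * u * v * w) with hXdef
  set Y := exp (L / x) with hYdef
  have hN0 : 0 < N := by linarith
  have hT0 : (0 : ℝ) < g * u * v * w := by positivity
  have hY1 : 1 ≤ Y := one_le_exp (by positivity)
  have hX1 : 1 ≤ X := hY1.trans hY.le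
  have hTN : (g * u * v * w : ℝ) ≤ N := by rwa [hXdef, one_le_div hT0] at hX1
  set m := 2 * (g * u * v * w) * ((u : ℤ) ^ 4 - v ^ 4).natAbs with hmdef
  have hm0 : m ≠ 0 := discriminant_ne_zero hg hu hv hw huv
  have hmL : log m ≤ 6 * L := log_discriminant_le hg hu hv hw huv hN hTN
  set r := ⌈84 * x⌉₊ with hrdef
  have hr1 : 84 * x ≤ r := Nat.le_ceil _
  have hr2 : (r : ℝ) ≤ 85 * x := by
    have := Nat.ceil_lt_add_one (by positivity : 0 ≤ 84 * x)
    rw [← hrdef] at this; linarith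
  have hr0 : (0 : ℝ) < r := by linarith
  set z := exp (L / (4 * r * x)) with hzdef
  have hz1 : 1 ≤ z := one_le_exp (by positivity)
  have hzY : z ≤ Y := exp_le_exp.2 (by
    gcongr
    nlinarith)
  have hYN : Y ≤ N := by
    rw [← exp_log hN0]
    exact exp_le_exp.2 (div_le_self hL0.le hx)
  set Z := ⌊z⌋₊ + 1 with hZdef
  have hZ2 : 2 ≤ Z := by
    have : 1 ≤ ⌊z⌋₊ := Nat.le_floor (by simpa using hz1)
    omega
  have hzZ : z ≤ Z := by rw [hZdef]; push_cast; exact (Nat.lt_floor_add_one z).le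
  set P := Z.primesBelow.filter fun p => ¬ p ∣ m with hPdef
  have hPp : ∀ p ∈ P, p.Prime := fun p hp =>
    Nat.prime_of_mem_primesBelow (Finset.mem_filter.1 hp).1
  have hPz : ∀ p ∈ P, (p : ℝ) ≤ z := by
    intro p hp
    have := Nat.lt_of_mem_primesBelow (Finset.mem_filter.1 hp).1
    exact (Nat.le_floor_iff (by linarith)).1 (by omega)
  have hPcard : (P.card : ℝ) ≤ z := by
    have h1 : P ⊆ Finset.Ioc 0 ⌊z⌋₊ := fun p hp =>
      Finset.mem_Ioc.2 ⟨(hPp p hp).pos, Nat.le_floor (hPz p hp)⟩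
    have h2 := Finset.card_le_card h1
    rw [Nat.card_Ioc, Nat.sub_zero] at h2
    exact (by exact_mod_cast h2 : (P.card : ℝ) ≤ ⌊z⌋₊).trans (Nat.floor_le (by linarith))
  have hex : ∀ p : ℕ, ∃ Ω : Finset (ZMod p), p ∈ P →
      (Ω.card : ℝ) = 3 + 2 * (ZMod.χ₄ p : ℝ) ∧ ∀ y ∈ Ω, y = 0 ∨
        ((g : ZMod p) * u) ^ 2 + (v * w) ^ 2 * y ^ 2 = 0 ∨
        ((g : ZMod p) * v) ^ 2 + (u * w) ^ 2 * y ^ 2 = 0 := by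
    intro p
    by_cases hp : p ∈ P
    · have hpm : ¬ p ∣ m := (Finset.mem_filter.1 hp).2
      obtain ⟨Ω, hΩ⟩ := exists_sifted_classes (g := g) (u := u) (v := v) (w := w) (hPp p hp)
        (fun h => hpm (h ▸ ⟨(g * u * v * w) * ((u : ℤ) ^ 4 - v ^ 4).natAbs,
          by rw [hmdef]; ring⟩))
        (fun h => hpm (h.trans ⟨2 * (u * v * w) * ((u : ℤ) ^ 4 - v ^ 4).natAbs,
          by rw [hmdef]; ring⟩))
        (fun h => hpm (h.trans ⟨2 * (g * v * w) * ((u : ℤ) ^ 4 - v ^ 4).natAbs,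
          by rw [hmdef]; ring⟩))
        (fun h => hpm (h.trans ⟨2 * (g * u * w) * ((u : ℤ) ^ 4 - v ^ 4).natAbs,
          by rw [hmdef]; ring⟩))
        (fun h => hpm (h.trans ⟨2 * (g * u * v) * ((u : ℤ) ^ 4 - v ^ 4).natAbs,
          by rw [hmdef]; ring⟩))
        (fun h => hpm ((Int.natCast_dvd.1 h).trans (Dvd.intro_left _ rfl)))
      exact ⟨Ω, fun _ => hΩ⟩
    · exact ⟨∅, fun h => absurd h hp⟩
  choose Ω hΩ using hex
  have hκ : ∀ p ∈ P, (Ω p).card ≤ 5 := by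
    intro p hp
    have h1 := (hΩ p hp).1
    have h2 : ((Ω p).card : ℝ) ≤ 5 := by
      rw [h1]
      rcases chi_mem p with h | h | h <;> rw [h] <;> norm_num
    exact_mod_cast h2
  have hρ : ∑ p ∈ P, ((Ω p).card / p : ℝ) = ∑ p ∈ P, ((3 + 2 * ZMod.χ₄ p : ℝ) / p) :=
    Finset.sum_congr rfl fun p hp => by rw [(hΩ p hp).1]
  have hsieve := brun_sieve P hPp Ω hκ hz1 hPcard (⌊X⌋₊ + 1) r
  rw [hρ] at hsieve
  have hmain : exp (-∑ p ∈ P, ((3 + 2 * ZMod.χ₄ p : ℝ) / p)) ≤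
      C₀ * 340 ^ 3 * (x ^ 26 / L ^ 3) := by
    refine (hdens Z m L hZ2 hm0 hL hmL).trans ?_
    have h1 : L / (340 * x ^ 2) ≤ log Z := by
      calc L / (340 * x ^ 2) ≤ L / (4 * r * x) :=
            div_le_div_of_nonneg_left hL0.le (by positivity) (by nlinarith)
        _ = log z := (log_exp _).symm
        _ ≤ log Z := log_le_log (exp_pos _) hzZ
    calc C₀ * x ^ 20 / log Z ^ 3 ≤ C₀ * x ^ 20 / (L / (340 * x ^ 2)) ^ 3 := by gcongr
      _ = C₀ * 340 ^ 3 * (x ^ 26 / L ^ 3) := by field_simp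
  have htail : exp (exp 1 * ∑ p ∈ P, ((3 + 2 * ZMod.χ₄ p : ℝ) / p) - (2 * r : ℕ)) ≤
      x ^ 26 / L ^ 3 := by
    have h1 := sum_density_le hN fun p hp => ⟨hPp p hp, (hPz p hp).trans (hzY.trans hYN)⟩
    have h2 : exp (exp 1 * ∑ p ∈ P, ((3 + 2 * ZMod.χ₄ p : ℝ) / p) - (2 * r : ℕ)) ≤ 1 / L ^ 3 := by
      rw [hLx, ← exp_nat_mul, one_div, ← exp_neg, exp_le_exp]
      push_cast; linarith
    exact h2.trans (by gcongr; exact one_le_pow₀ hx)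
  have herr : exp (5 : ℕ) * z ^ (2 * r) ≤ exp 32 * X * (x ^ 26 / L ^ 3) := by
    have h1 : z ^ (2 * r) = Y * exp (-(exp x / (2 * x))) := by
      rw [hzdef, ← exp_nat_mul, hYdef, ← exp_add, ← hLx]
      congr 1
      push_cast
      field_simp
      ring
    have h3 : exp 27 / exp x ^ 3 ≤ exp 27 * (x ^ 26 / L ^ 3) := by
      rw [← hLx, mul_div_assoc']
      gcongr
      exact le_mul_of_one_le_right (exp_pos _).le (one_le_pow₀ hx)
    calc exp (5 : ℕ) * z ^ (2 * r) ≤ exp 5 * (X * (exp 27 * (x ^ 26 / L ^ 3))) := by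
          rw [h1]
          push_cast
          gcongr
          exact (exp_neg_half_div_le hx).trans h3
      _ = _ := by
          rw [show (32 : ℝ) = 5 + 27 by norm_num, exp_add]; ring
  have hM : ((⌊X⌋₊ + 1 : ℕ) : ℝ) ≤ 2 * X := by
    have := Nat.floor_le (by linarith : 0 ≤ X)
    push_cast; linarith
  have hcard : ({ℓ : ℕ | ℓ.Prime ∧ Y < (ℓ : ℝ) ∧ (ℓ : ℝ) ≤ X ∧
        Nat.Prime ((g * u) ^ 2 + (v * w) ^ 2 * ℓ ^ 2) ∧
        Nat.Prime ((g * v) ^ 2 + (u * w) ^ 2 * ℓ ^ 2)}.ncard : ℝ) ≤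
      ((Finset.range (⌊X⌋₊ + 1)).filter fun n : ℕ => ∀ p ∈ P, (n : ZMod p) ∉ Ω p).card := by
    rw [← Set.ncard_coe_finset]
    refine Nat.cast_le.2 (Set.ncard_le_ncard ?_ (Finset.finite_toSet _))
    rintro ℓ ⟨h1, h2, h3, h4, h5⟩
    simp only [Finset.coe_filter, Set.mem_ofPred_eq, Finset.mem_range]
    refine ⟨Nat.lt_succ_of_le (Nat.le_floor h3), fun p hp => ?_⟩
    exact not_mem_sifted_classes hu hv hw (hPp p hp)
      (by exact_mod_cast (hPz p hp).trans_lt (hzY.trans_lt h2)) h1 h4 h5 (hΩ p hp).2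
  refine hcard.trans (hsieve.trans ?_)
  calc _ ≤ 2 * X * (C₀ * 340 ^ 3 * (x ^ 26 / L ^ 3) + x ^ 26 / L ^ 3) +
        exp 32 * X * (x ^ 26 / L ^ 3) := by gcongr
    _ = _ := by ring

theorem stmt_11 :
    ∃ C K : ℝ, 0 < C ∧ 0 ≤ K ∧ ∀ N : ℝ, 16 ≤ N →
      ∀ g u v w : ℕ, 0 < g → 0 < u → 0 < v → 0 < w →
        Nat.Coprime g u → Nat.Coprime g v → Nat.Coprime g w →
        Nat.Coprime u v → Nat.Coprime u w → Nat.Coprime v w → u ≠ v →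
      ({ℓ : ℕ | ℓ.Prime ∧ N ^ (1 / Real.log (Real.log N)) < (ℓ : ℝ) ∧
          (ℓ : ℝ) ≤ N / (g * u * v * w) ∧
          Nat.Prime ((g * u) ^ 2 + (v * w) ^ 2 * ℓ ^ 2) ∧
          Nat.Prime ((g * v) ^ 2 + (u * w) ^ 2 * ℓ ^ 2)}.ncard : ℝ)
        ≤ C * N * Real.log (Real.log N) ^ K / (g * u * v * w * Real.log N ^ 3) := by
  obtain ⟨C, hC, h⟩ := card_sifted_le
  refine ⟨C, (26 : ℕ), hC, by positivity, ?_⟩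
  intro N hN g u v w hg hu hv hw _ _ _ _ _ _ huv
  have hL := exp_one_le_log hN
  have hL0 : 0 < log N := (exp_pos 1).trans_le hL
  have hx : 1 ≤ log (log N) := (le_log_iff_exp_le hL0).2 hL
  have hN0 : 0 < N := by linarith
  rw [rpow_one_div_log_log hN0, rpow_natCast]
  by_cases hY : exp (log N / log (log N)) < N / (g * u * v * w)
  · refine (h N hN g u v w hg hu hv hw huv hY).trans (le_of_eq ?_)
    ring
  · have hempty : {ℓ : ℕ | ℓ.Prime ∧ exp (log N / log (log N)) < (ℓ : ℝ) ∧
        (ℓ : ℝ) ≤ N / (g * u * v * w) ∧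
        Nat.Prime ((g * u) ^ 2 + (v * w) ^ 2 * ℓ ^ 2) ∧
        Nat.Prime ((g * v) ^ 2 + (u * w) ^ 2 * ℓ ^ 2)} = ∅ :=
      Set.eq_empty_of_forall_notMem fun ℓ hl => hY (hl.2.1.trans_le hl.2.2.1)
    rw [hempty, Set.ncard_empty, Nat.cast_zero]
    positivity
end

section
/- There exists a constant C > 0 such that for all sufficiently large real N, the number of ordered pairs (a, b) of positive integers with 1 < ab ≤ N, a² + b² prime, and P(ab) ≤ N^{1/log log N} is at most C · N / log N. -/
open Real

open Filter
open Nat (primesLE smoothNumbers)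

theorem sum_primesLE_log_div_le {n : ℕ} (hn : n ≠ 0) :
    ∑ p ∈ primesLE n, log p / p ≤ log n + log 4 := by
  have hn' : (0 : ℝ) < n := by positivity
  have hdiv {p : ℕ} (hp : p.Prime) : n / p ≤ n.factorial.factorization p := by
    rw [Nat.factorization_factorial hp (Nat.lt_succ_self _)]
    by_cases h : p ≤ n
    · calc n / p = n / p ^ 1 := by simp
        _ ≤ _ := Finset.single_le_sum (f := fun i ↦ n / p ^ i) (fun _ _ ↦ Nat.zero_le _)
          (Finset.mem_Ico.2 ⟨le_rfl, Nat.succ_lt_succ (Nat.log_pos hp.one_lt h)⟩)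
    · simp [Nat.div_eq_of_lt (not_le.1 h)]
  have hfact : ∑ p ∈ primesLE n, (n.factorial.factorization p : ℝ) * log p = log n.factorial := by
    rw [log_nat_eq_sum_factorization, Finsupp.sum]
    symm
    apply Finset.sum_subset
    · intro p hp
      have hp' := Nat.prime_of_mem_primeFactors hp
      exact Nat.mem_primesLE.2 ⟨(hp'.dvd_factorial).1 (Nat.dvd_of_mem_primeFactors hp), hp'⟩
    · intro p _ hp
      simp [Finsupp.notMem_support_iff.1 hp]
  have hlog : log n.factorial ≤ n * log n := by
    rw [← log_pow]
    exact log_le_log (by positivity) (by exact_mod_cast Nat.factorial_le_pow n)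
  have htheta : ∑ p ∈ primesLE n, log p ≤ log 4 * n := by
    rw [← Chebyshev.theta_eq_sum_primesLE_log]
    exact Chebyshev.theta_le_log4_mul_x hn'.le
  have hterm : ∀ p ∈ primesLE n,
      n * (log p / p) ≤ (n.factorial.factorization p : ℝ) * log p + log p := by
    intro p hp
    have hp := (Nat.mem_primesLE.1 hp).2
    have h1 : (n : ℝ) / p ≤ n.factorial.factorization p + 1 :=
      (Nat.lt_floor_add_one _).le.trans (by
        rw [Nat.floor_div_eq_div]
        gcongr
        exact hdiv hp)
    calc n * (log p / p) = n / p * log p := by ring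
      _ ≤ (n.factorial.factorization p + 1) * log p := by
        gcongr
      _ = _ := by ring
  have := Finset.sum_le_sum hterm
  rw [← Finset.mul_sum, Finset.sum_add_distrib, hfact] at this
  refine le_of_mul_le_mul_left ?_ hn'
  linarith

/-- The completely multiplicative function `n ↦ n ^ (-s)` on the natural numbers. -/
noncomputable def rpowNegHom (s : ℝ) : ℕ →* ℝ where
  toFun n := (n : ℝ) ^ (-s)
  map_one' := by simp
  map_mul' m n := by simp [mul_rpow]

theorem rpowNegHom_apply (s : ℝ) (n : ℕ) : rpowNegHom s n = (n : ℝ) ^ (-s) := rfl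

theorem rpowNegHom_lt_one {s : ℝ} (hs : 0 < s) {p : ℕ} (hp : p.Prime) :
    ‖rpowNegHom s p‖ < 1 := by
  rw [rpowNegHom_apply, norm_of_nonneg (by positivity)]
  exact rpow_lt_one_of_one_lt_of_neg (by exact_mod_cast hp.one_lt) (by linarith)

theorem summable_rpowNegHom {s : ℝ} (hs : 1 < s) : Summable (rpowNegHom s) :=
  summable_nat_rpow.2 (neg_lt_neg hs)

theorem tsum_rpowNegHom_le {s : ℝ} (hs : 1 < s) : ∑' n, rpowNegHom s n ≤ s / (s - 1) := by
  have h0 : 0 ≤ ZetaAsymptotics.termTSum s :=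
    tsum_nonneg fun n ↦ ZetaAsymptotics.term_nonneg _ _
  rw [ZetaAsymptotics.termTSum_of_lt hs] at h0
  have h1 : ∑' n, rpowNegHom s n = ∑' n : ℕ, 1 / (n + 1 : ℝ) ^ s := by
    rw [(summable_rpowNegHom hs).tsum_eq_zero_add]
    simp only [rpowNegHom_apply, Nat.cast_zero, Nat.cast_add, Nat.cast_one]
    rw [zero_rpow (by linarith), zero_add]
    exact tsum_congr fun n ↦ by rw [rpow_neg (by positivity), one_div]
  rw [h1]
  have hs0 : 0 < s := by linarith
  calc _ = s * (1 / s * ∑' n : ℕ, 1 / (n + 1 : ℝ) ^ s) := by field_simp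
    _ ≤ s * (1 / (s - 1)) := by gcongr; linarith
    _ = _ := by ring

theorem sum_primesLE_rpow_neg_le {s : ℝ} (hs : 1 < s) (n : ℕ) :
    ∑ p ∈ primesLE n, (p : ℝ) ^ (-s) ≤ log (s / (s - 1)) := by
  have hs0 : 0 < s := by linarith
  have hlt {p : ℕ} (hp : p ∈ primesLE n) : (p : ℝ) ^ (-s) < 1 := by
    simpa [rpowNegHom_apply, abs_of_nonneg (rpow_nonneg (Nat.cast_nonneg p) (-s))] using
      rpowNegHom_lt_one hs0 (Nat.mem_primesLE.1 hp).2
  have hprod : ∏ p ∈ primesLE n, (1 - (p : ℝ) ^ (-s))⁻¹ ≤ s / (s - 1) := by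
    have := EulerProduct.prod_primesBelow_geometric_eq_tsum_smoothNumbers
      (summable_rpowNegHom hs) (n + 1)
    simp only [rpowNegHom_apply] at this
    rw [primesLE, this]
    exact ((summable_rpowNegHom hs).tsum_subtype_le (f := rpowNegHom s) _
      fun m ↦ rpow_nonneg (Nat.cast_nonneg m) _).trans (tsum_rpowNegHom_le hs)
  have hpos {p : ℕ} (hp : p ∈ primesLE n) : 0 < (1 - (p : ℝ) ^ (-s))⁻¹ :=
    inv_pos.2 (sub_pos.2 (hlt hp))
  refine le_trans ?_ (log_le_log (Finset.prod_pos fun p hp ↦ hpos hp) hprod)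
  rw [log_prod fun p hp ↦ (hpos hp).ne']
  refine Finset.sum_le_sum fun p hp ↦ ?_
  rw [log_inv]
  linarith [log_le_sub_one_of_pos (sub_pos.2 (hlt hp))]

/-- A Mertens-type bound for the sum of `p ^ (-σ)` over primes `p ≤ exp L`, where `1 - σ` is of
order `1 / L`. -/
theorem sum_primesLE_rpow_neg_one_sub_le {c L : ℝ} (hc : 0 ≤ c) (hL : log 4 ≤ L) {n : ℕ}
    (hn : n ≠ 0) (hnL : log n ≤ L) :
    ∑ p ∈ primesLE n, (p : ℝ) ^ (-(1 - c / L)) ≤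
      log (L + 1) + 2 * (c + 1) * exp (c + 1) := by
  have hL0 : 0 < L := (log_pos (by norm_num)).trans_le hL
  have hs : 1 < 1 + 1 / L := by simp [hL0]
  have hterm : ∀ p ∈ primesLE n, (p : ℝ) ^ (-(1 - c / L)) ≤
      (p : ℝ) ^ (-(1 + 1 / L)) + (c + 1) * exp (c + 1) / L * (log p / p) := by
    intro p hp
    obtain ⟨hpn, hp⟩ := Nat.mem_primesLE.1 hp
    have hp0 : (0 : ℝ) < p := by exact_mod_cast hp.pos
    have hp1 : (1 : ℝ) ≤ p := by exact_mod_cast hp.one_le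
    have hlp : 0 ≤ log p := log_nonneg hp1
    have hlpL : log p ≤ L := (log_le_log hp0 (by exact_mod_cast hpn)).trans hnL
    set t := (c + 1) / L * log p with ht
    have ht0 : 0 ≤ t := by positivity
    have htc : t ≤ c + 1 := by
      rw [ht, div_mul_eq_mul_div, div_le_iff₀ hL0]
      gcongr
    have hsplit : (p : ℝ) ^ (-(1 - c / L)) = (p : ℝ) ^ (-(1 + 1 / L)) * exp t := by
      rw [rpow_def_of_pos hp0, rpow_def_of_pos hp0, ← exp_add]
      congr 1
      rw [ht]; ring
    have hexp : exp t ≤ 1 + t * exp t := by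
      have h1 := add_one_le_exp (-t)
      have h2 : exp (-t) * exp t = 1 := by rw [← exp_add]; simp
      nlinarith [exp_pos t]
    have hle : (p : ℝ) ^ (-(1 + 1 / L)) ≤ (p : ℝ)⁻¹ := by
      rw [← rpow_neg_one]
      exact rpow_le_rpow_of_exponent_le hp1 (by linarith)
    rw [hsplit]
    calc (p : ℝ) ^ (-(1 + 1 / L)) * exp t
        ≤ (p : ℝ) ^ (-(1 + 1 / L)) * (1 + t * exp t) := by gcongr
      _ = (p : ℝ) ^ (-(1 + 1 / L)) + (p : ℝ) ^ (-(1 + 1 / L)) * (t * exp t) := by ring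
      _ ≤ (p : ℝ) ^ (-(1 + 1 / L)) + (p : ℝ)⁻¹ * (t * exp (c + 1)) := by gcongr
      _ = _ := by rw [ht]; field_simp
  refine (Finset.sum_le_sum hterm).trans ?_
  rw [Finset.sum_add_distrib, ← Finset.mul_sum]
  gcongr ?_ + ?_
  · refine (sum_primesLE_rpow_neg_le hs n).trans_eq ?_
    congr 1
    field_simp
    ring
  · calc _ ≤ (c + 1) * exp (c + 1) / L * (L + L) := by
          gcongr
          exact (sum_primesLE_log_div_le hn).trans (by gcongr)
      _ = _ := by field_simp; ring

theorem prod_primesLE_one_sub_inv_le {s : ℝ} (hs : 3 / 4 ≤ s) (n : ℕ) :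
    ∏ p ∈ primesLE n, (1 - (p : ℝ) ^ (-s))⁻¹ ≤
      exp (3 * ∑ p ∈ primesLE n, (p : ℝ) ^ (-s)) := by
  rw [Finset.mul_sum, exp_sum]
  have hle {p : ℕ} (hp : p ∈ primesLE n) : (p : ℝ) ^ (-s) ≤ 2 / 3 := by
    have hp := (Nat.mem_primesLE.1 hp).2
    have h2 : (2 : ℝ) ≤ p := by exact_mod_cast hp.two_le
    calc (p : ℝ) ^ (-s) ≤ (p : ℝ) ^ (-(3 / 4 : ℝ)) :=
          rpow_le_rpow_of_exponent_le (by linarith) (by linarith)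
      _ ≤ 2 ^ (-(3 / 4 : ℝ)) := rpow_le_rpow_of_nonpos (by norm_num) h2 (by norm_num)
      _ ≤ 2 / 3 := by
        refine le_of_pow_le_pow_left₀ (n := 4) (by norm_num) (by norm_num) ?_
        rw [← rpow_natCast, ← rpow_mul (by norm_num)]
        norm_num
  refine Finset.prod_le_prod (fun p hp ↦ inv_nonneg.2 (by linarith [hle hp])) fun p hp ↦ ?_
  set x := (p : ℝ) ^ (-s)
  have hx0 : 0 ≤ x := by positivity
  have hx := hle hp
  refine le_trans ?_ (add_one_le_exp _)
  rw [inv_le_iff_one_le_mul₀ (by linarith)]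
  nlinarith

theorem sum_smoothNumbers_rpow_neg_le {s : ℝ} (hs : 0 < s) {n : ℕ} (A : Finset ℕ)
    (hA : (A : Set ℕ) ⊆ smoothNumbers (n + 1)) :
    ∑ a ∈ A, (a : ℝ) ^ (-s) ≤ ∏ p ∈ primesLE n, (1 - (p : ℝ) ^ (-s))⁻¹ := by
  obtain ⟨hsum, hhas⟩ := EulerProduct.summable_and_hasSum_smoothNumbers_prod_primesBelow_geometric
    (f := rpowNegHom s) (rpowNegHom_lt_one hs) (n + 1)
  have := sum_le_hasSum (A.subtype (· ∈ smoothNumbers (n + 1)))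
    (fun m _ ↦ rpow_nonneg (Nat.cast_nonneg m.1) (-s)) hhas
  rwa [Finset.sum_subtype_of_mem (f := fun a : ℕ ↦ (a : ℝ) ^ (-s)) fun a ha ↦ hA ha] at this

/-- Rankin's trick for pairs of smooth numbers with bounded product. -/
theorem card_smooth_pairs_le {s N : ℝ} (hs : 0 < s) (hN : 0 ≤ N) {n : ℕ} (T : Finset (ℕ × ℕ))
    (hT : ∀ q ∈ T, q.1 ∈ smoothNumbers (n + 1) ∧ q.2 ∈ smoothNumbers (n + 1) ∧
      ((q.1 * q.2 : ℕ) : ℝ) ≤ N) :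
    (T.card : ℝ) ≤ N ^ s * (∏ p ∈ primesLE n, (1 - (p : ℝ) ^ (-s))⁻¹) ^ 2 := by
  have hterm : ∀ q ∈ T, (1 : ℝ) ≤ N ^ s * ((q.1 : ℝ) ^ (-s) * (q.2 : ℝ) ^ (-s)) := by
    intro q hq
    obtain ⟨h1, h2, h3⟩ := hT q hq
    have h0 : (0 : ℝ) < (q.1 * q.2 : ℕ) := by
      exact_mod_cast Nat.pos_of_ne_zero (mul_ne_zero h1.1 h2.1)
    rw [← mul_rpow (by positivity) (by positivity), ← Nat.cast_mul, rpow_neg h0.le,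
      ← div_eq_mul_inv, one_le_div (by positivity)]
    gcongr
  calc (T.card : ℝ) = ∑ q ∈ T, (1 : ℝ) := by simp
    _ ≤ ∑ q ∈ T, N ^ s * ((q.1 : ℝ) ^ (-s) * (q.2 : ℝ) ^ (-s)) := Finset.sum_le_sum hterm
    _ ≤ ∑ q ∈ T.image Prod.fst ×ˢ T.image Prod.snd,
          N ^ s * ((q.1 : ℝ) ^ (-s) * (q.2 : ℝ) ^ (-s)) :=
        Finset.sum_le_sum_of_subset_of_nonneg Finset.subset_product fun _ _ _ ↦ by positivity
    _ = N ^ s * ((∑ a ∈ T.image Prod.fst, (a : ℝ) ^ (-s)) *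
          ∑ b ∈ T.image Prod.snd, (b : ℝ) ^ (-s)) := by
        rw [← Finset.mul_sum, Finset.sum_mul_sum, Finset.sum_product]
    _ ≤ _ := by
        rw [sq]
        have hfst := sum_smoothNumbers_rpow_neg_le hs (n := n) (T.image Prod.fst) (by
          simpa [Set.subset_def] using fun a b hab ↦ (hT (a, b) hab).1)
        have hsnd := sum_smoothNumbers_rpow_neg_le hs (n := n) (T.image Prod.snd) (by
          simpa [Set.subset_def] using fun b a hab ↦ (hT (a, b) hab).2.1)
        gcongr
        exact (Finset.sum_nonneg fun _ _ ↦ by positivity).trans hfst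

theorem mem_smoothNumbers_of_maxPrimeFac_le {m k : ℕ} (hm : 1 < m) (h : maxPrimeFac m ≤ k) :
    m ∈ smoothNumbers (k + 1) := by
  refine Nat.mem_smoothNumbers.2 ⟨by lia, fun p hp ↦ ?_⟩
  rw [maxPrimeFac, if_neg (by lia)] at h
  exact Nat.lt_succ_of_le ((Finset.le_sup (f := id) (List.mem_toFinset.2 hp)).trans h)

theorem stmt_13 :
    ∃ C : ℝ, 0 < C ∧ ∃ N₀ : ℝ, ∀ N : ℝ, N₀ ≤ N →
      ({p : ℕ × ℕ | 0 < p.1 ∧ 0 < p.2 ∧ 1 < p.1 * p.2 ∧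
          ((p.1 * p.2 : ℕ) : ℝ) ≤ N ∧ Nat.Prime (p.1 ^ 2 + p.2 ^ 2) ∧
          (maxPrimeFac (p.1 * p.2) : ℝ) ≤ N ^ (1 / Real.log (Real.log N))}.ncard : ℝ)
        ≤ C * N / Real.log N := by
  refine ⟨exp (6 * (2 * (7 + 1) * exp (7 + 1))), exp_pos _, ?_⟩
  have hlarge : ∀ᶠ x : ℝ in atTop, 2 ≤ x ∧ 2 ≤ log x ∧ 28 ≤ x / log x := by
    have h : Tendsto (fun x : ℝ ↦ x / log x) atTop atTop := by
      have := (tendsto_exp_div_pow_atTop 1).comp tendsto_log_atTop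
      refine this.congr' ?_
      filter_upwards [eventually_gt_atTop 0] with x hx
      simp [exp_log hx]
    exact (eventually_ge_atTop 2).and ((tendsto_log_atTop.eventually_ge_atTop 2).and
      (h.eventually_ge_atTop 28))
  obtain ⟨N₀, hN₀⟩ := eventually_atTop.1
    ((tendsto_log_atTop.eventually hlarge).and (eventually_gt_atTop 0))
  refine ⟨N₀, fun N hN ↦ ?_⟩
  obtain ⟨⟨hx, hlx, hL⟩, hN0⟩ := hN₀ N hN
  set x := log N with hxdef
  set L := x / log x with hLdef
  set n := ⌊N ^ (1 / log x)⌋₊ with hn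
  have hy : N ^ (1 / log x) = exp L := by
    rw [rpow_def_of_pos hN0, hLdef, ← hxdef]
    ring_nf
  have hn0 : n ≠ 0 := by
    rw [hn, hy]
    exact (Nat.floor_pos.2 (one_le_exp (by linarith))).ne'
  have hnL : log n ≤ L := by
    rw [log_le_iff_le_exp (by positivity), ← hy]
    exact Nat.floor_le (by positivity)
  have hL4 : log 4 ≤ L := by linarith [log_le_sub_one_of_pos (show (0 : ℝ) < 4 by norm_num)]
  have hLx : L + 1 ≤ x := by
    have : L ≤ x / 2 := by rw [hLdef]; gcongr
    linarith
  have h7 : 7 / L ≤ 1 / 4 := by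
    rw [div_le_div_iff₀ (by linarith) (by norm_num)]
    linarith
  have hNs : N ^ (1 - 7 / L) = N / x ^ 7 := by
    rw [rpow_sub hN0, rpow_one, rpow_def_of_pos hN0, ← hxdef, hLdef]
    congr 1
    rw [show x * (7 / (x / log x)) = (7 : ℕ) * log x by push_cast; field_simp, exp_nat_mul,
      exp_log (by linarith)]
  have hprod : (∏ p ∈ primesLE n, (1 - (p : ℝ) ^ (-(1 - 7 / L)))⁻¹) ^ 2 ≤
      x ^ 6 * exp (6 * (2 * (7 + 1) * exp (7 + 1))) := by
    have hlog := sum_primesLE_rpow_neg_one_sub_le (c := 7) (by norm_num) hL4 hn0 hnL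
    have hP := prod_primesLE_one_sub_inv_le (s := 1 - 7 / L) (by linarith) n
    have hP0 : 0 ≤ ∏ p ∈ primesLE n, (1 - (p : ℝ) ^ (-(1 - 7 / L)))⁻¹ := by
      simpa using sum_smoothNumbers_rpow_neg_le (s := 1 - 7 / L) (by linarith) (n := n) ∅ (by simp)
    calc _ ≤ exp (3 * (log x + 2 * (7 + 1) * exp (7 + 1))) ^ 2 := by
          gcongr
          refine hP.trans ?_
          gcongr
          refine hlog.trans ?_
          gcongr
      _ = exp ((6 : ℕ) * log x) * exp (6 * (2 * (7 + 1) * exp (7 + 1))) := by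
          rw [← exp_nat_mul, ← exp_add]
          congr 1
          push_cast
          ring
      _ = _ := by rw [exp_nat_mul, exp_log (by linarith)]
  set S := {p : ℕ × ℕ | _}
  have hS : ∀ q ∈ S, q.1 ∈ smoothNumbers (n + 1) ∧ q.2 ∈ smoothNumbers (n + 1) ∧
      ((q.1 * q.2 : ℕ) : ℝ) ≤ N := by
    rintro ⟨a, b⟩ ⟨-, -, hab, habN, -, hP⟩
    have hmem := mem_smoothNumbers_of_maxPrimeFac_le hab (Nat.le_floor hP)
    exact ⟨Nat.mem_smoothNumbers_of_dvd hmem (Nat.dvd_mul_right a b),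
      Nat.mem_smoothNumbers_of_dvd hmem (Nat.dvd_mul_left b a), habN⟩
  have hfin : S.Finite := by
    refine ((Set.finite_Iic ⌊N⌋₊).prod (Set.finite_Iic ⌊N⌋₊)).subset ?_
    rintro ⟨a, b⟩ ⟨ha, hb, -, habN, -⟩
    have := Nat.le_floor habN
    exact ⟨(Nat.le_mul_of_pos_right a hb).trans this, (Nat.le_mul_of_pos_left b ha).trans this⟩
  rw [Set.ncard_eq_toFinset_card S hfin]
  calc _ ≤ N ^ (1 - 7 / L) * (∏ p ∈ primesLE n, (1 - (p : ℝ) ^ (-(1 - 7 / L)))⁻¹) ^ 2 :=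
        card_smooth_pairs_le (by linarith) hN0.le _ fun q hq ↦ hS q (hfin.mem_toFinset.1 hq)
    _ ≤ N / x ^ 7 * (x ^ 6 * exp (6 * (2 * (7 + 1) * exp (7 + 1)))) := by
        rw [hNs]
        gcongr
    _ = _ := by
        field_simp
end
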